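/- Fix β > 0. Suppose Φ : ℝ × ℂ^ℤ → ℂ^ℤ is such that Φ(t,·) is Borel measurable for every t ∈ ℝ, and for μ_wn^β-almost every a ∈ ℂ^ℤ the map (n,t) ↦ Φ(t,a)_n is a global good solution of the Ablowitz–Ladik system with Φ(0,a) = a. Then for every t ∈ ℝ the pushforward of μ_wn^β under Φ(t,·) equals μ_wn^β. -/

import Mathlib

open MeasureTheory
open scoped ENNReal BigOperators
noncomputable section

/-- The japanese bracket ⟨n⟩ = (1+n²)^{1/2}. -/
def jap (n : ℤ) : ℝ := Real.sqrt (1 + (n : ℝ)^2)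

/-- `α : ℤ × ℝ → ℂ` is a (global) solution of the focusing Ablowitz–Ladik system:
each t ↦ α_n(t) is differentiable and i·(d/dt)α_n = −(1+|α_n|²)(α_{n+1}+α_{n−1}) + 2α_n. -/
def ALSolution (α : ℤ → ℝ → ℂ) : Prop :=
  ∀ (n : ℤ) (t : ℝ), ∃ d : ℂ,
    HasDerivAt (α n) d t ∧
    Complex.I * d
      = -(1 + (Complex.normSq (α n t) : ℂ)) * (α (n+1) t + α (n-1) t) + 2 * α n t

/-- A good solution of the Ablowitz–Ladik system: a global solution satisfying
(i) ∃ p > q > 1 with ∫_{−T}^{T} Σ_n ⟨n⟩^{−q} |α_n(t)|^{2p} dt < ∞ for all T > 0, and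
(ii) ∃ c > 0 with sup_{|t|≤T} Σ_n e^{−c⟨n⟩} |α_n(t)|² < ∞ for all T > 0. -/
def IsGoodALSolution (α : ℤ → ℝ → ℂ) : Prop :=
  ALSolution α ∧
  (∃ p q : ℝ, 1 < q ∧ q < p ∧ ∀ T > (0:ℝ),
    (∫⁻ t in Set.Icc (-T) T, ∑' n : ℤ,
      ENNReal.ofReal (jap n ^ (-q) * ‖α n t‖ ^ (2*p))) < ⊤) ∧
  (∃ c > (0:ℝ), ∀ T > (0:ℝ),
    (⨆ t ∈ Set.Icc (-T) T, ∑' n : ℤ,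
      ENNReal.ofReal (Real.exp (-(c * jap n)) * ‖α n t‖ ^ 2)) < ⊤)

/-- The one-site measure with density z ↦ (1+2β)/(π(1+|z|²)^{2+2β}) with respect to Lebesgue
measure on ℂ. -/
def muBeta (β : ℝ) : Measure ℂ :=
  (volume : Measure ℂ).withDensity
    (fun z => ENNReal.ofReal ((1 + 2*β)/(Real.pi * (1 + Complex.normSq z) ^ (2 + 2*β))))

/-- `μ` is the white noise measure μ_wn^β on ℂ^ℤ: the probability measure whose
finite-dimensional marginals are products of the one-site measures `muBeta β`. -/
def IsWhiteNoise (β : ℝ) (μ : Measure (ℤ → ℂ)) : Prop :=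
  IsProbabilityMeasure μ ∧
  ∀ (F : Finset ℤ) (A : ℤ → Set ℂ), (∀ n, MeasurableSet (A n)) →
    μ {a : ℤ → ℂ | ∀ n ∈ F, a n ∈ A n} = ∏ n ∈ F, muBeta β (A n)

section WhiteNoiseInvariance

open Set Filter Topology
open scoped NNReal

section Flow

variable {E : Type*} [NormedAddCommGroup E] [NormedSpace ℝ E]

/-- `φ` is a global flow of the autonomous vector field `Y`. -/
structure IsGlobalFlow (Y : E → E) (φ : ℝ → E → E) : Prop where
  map_zero : ∀ x, φ 0 x = x
  hasDerivAt : ∀ x t, HasDerivAt (fun s => φ s x) (Y (φ t x)) t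

theorem LipschitzWith.exists_isGlobalFlow [CompleteSpace E] {Y : E → E} {K L : ℝ≥0}
    (hY : LipschitzWith K Y) (hL : ∀ x, ‖Y x‖ ≤ L) :
    ∃ φ : ℝ → E → E, IsGlobalFlow Y φ := by
  have hloc : ∀ (x : E) (n : ℕ), ∃ α : ℝ → E, α 0 = x ∧
      ∀ t ∈ Ioo (-(n + 1) : ℝ) (n + 1), HasDerivAt α (Y (α t)) t := by
    intro x n
    have h0 : (0 : ℝ) ∈ Icc (-(n + 1) : ℝ) (n + 1) := by
      constructor <;> linarith [n.cast_nonneg (α := ℝ)]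
    have hP : IsPicardLindelof (fun _ => Y) (tmin := -(n + 1)) (tmax := n + 1) ⟨0, h0⟩ x
        (L * (n + 1)) 0 L K :=
      .of_time_independent (fun y _ => hL y) hY.lipschitzOnWith (by simp)
    obtain ⟨α, hα0, hα⟩ := hP.exists_eq_forall_mem_Icc_hasDerivWithinAt₀
    exact ⟨α, hα0, fun t ht =>
      (hα t (Ioo_subset_Icc_self ht)).hasDerivAt (Icc_mem_nhds ht.1 ht.2)⟩
  choose α hα0 hα using hloc
  have hagree : ∀ x (m n : ℕ), m ≤ n → EqOn (α x m) (α x n) (Ioo (-(m + 1) : ℝ) (m + 1)) := by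
    intro x m n hmn
    have hmn' : (m : ℝ) ≤ n := by exact_mod_cast hmn
    refine ODE_solution_unique_of_mem_Ioo (v := fun _ => Y) (s := fun _ => univ) (t₀ := 0)
      (fun _ _ => hY.lipschitzOnWith) ?_
      (fun t ht => ⟨hα x m t ht, trivial⟩) (fun t ht => ⟨hα x n t ?_, trivial⟩) (by simp [hα0])
    · constructor <;> linarith [m.cast_nonneg (α := ℝ)]
    · exact ⟨by linarith [ht.1], by linarith [ht.2]⟩
  refine ⟨fun t x => α x ⌈|t|⌉₊ t, fun x => hα0 _ _, fun x t => ?_⟩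
  have key : ∀ s : ℝ, ∀ n : ℕ, |s| < n + 1 → α x ⌈|s|⌉₊ s = α x n s := by
    intro s n hs
    have hs' : |s| < (⌈|s|⌉₊ : ℝ) + 1 := by linarith [Nat.le_ceil |s|]
    rcases le_total ⌈|s|⌉₊ n with h | h
    · exact hagree x _ _ h (abs_lt.1 hs')
    · exact (hagree x _ _ h (abs_lt.1 hs)).symm
  have ht : |t| < (⌈|t|⌉₊ : ℝ) + 1 := by linarith [Nat.le_ceil |t|]
  refine (hα x ⌈|t|⌉₊ t (abs_lt.1 ht)).congr_of_eventuallyEq ?_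
  filter_upwards [(continuous_abs.tendsto t).eventually_lt_const ht] with s hs
  exact key s _ hs

namespace IsGlobalFlow

variable {Y : E → E} {φ : ℝ → E → E} {K : ℝ≥0}

theorem continuous_left (hφ : IsGlobalFlow Y φ) (x : E) : Continuous (fun t => φ t x) :=
  continuous_iff_continuousAt.2 fun t => (hφ.hasDerivAt x t).continuousAt

theorem map_add (hφ : IsGlobalFlow Y φ) (hY : LipschitzWith K Y) (s t : ℝ) (x : E) :
    φ (s + t) x = φ s (φ t x) := by
  have h : (fun s => φ (s + t) x) = fun s => φ s (φ t x) := by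
    refine ODE_solution_unique_univ (v := fun _ => Y) (s := fun _ => univ) (t₀ := 0)
      (K := K) (fun _ => hY.lipschitzOnWith) (fun s => ⟨?_, trivial⟩)
      (fun s => ⟨hφ.hasDerivAt _ s, trivial⟩) (by simp [hφ.map_zero])
    exact (hφ.hasDerivAt x (s + t)).comp_add_const s t
  exact congrFun h s

theorem dist_le_of_nonneg (hφ : IsGlobalFlow Y φ) (hY : LipschitzWith K Y) {t : ℝ} (ht : 0 ≤ t)
    (x y : E) : dist (φ t x) (φ t y) ≤ dist x y * Real.exp (K * t) := by
  have := dist_le_of_trajectories_ODE (v := fun _ => Y) (K := K) (a := 0) (b := t)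
    (f := fun s => φ s x) (g := fun s => φ s y) (δ := dist x y) (fun _ => hY)
    (hφ.continuous_left x).continuousOn (fun s _ => (hφ.hasDerivAt x s).hasDerivWithinAt)
    (hφ.continuous_left y).continuousOn (fun s _ => (hφ.hasDerivAt y s).hasDerivWithinAt)
    (by simp [hφ.map_zero]) t ⟨ht, le_rfl⟩
  simpa using this

theorem reverse (hφ : IsGlobalFlow Y φ) : IsGlobalFlow (fun x => -Y x) (fun t => φ (-t)) where
  map_zero x := by simp [hφ.map_zero]
  hasDerivAt x t := by
    have := (hφ.hasDerivAt x (-t)).scomp t (hasDerivAt_neg t)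
    simpa [Function.comp_def] using this

theorem lipschitzWith (hφ : IsGlobalFlow Y φ) (hY : LipschitzWith K Y) (t : ℝ) :
    LipschitzWith (Real.exp (K * |t|)).toNNReal (φ t) := by
  refine LipschitzWith.of_dist_le_mul fun x y => ?_
  rw [Real.coe_toNNReal _ (Real.exp_pos _).le, mul_comm]
  rcases le_total 0 t with ht | ht
  · rw [abs_of_nonneg ht]
    exact hφ.dist_le_of_nonneg hY ht x y
  · rw [abs_of_nonpos ht]
    simpa using hφ.reverse.dist_le_of_nonneg (K := K) hY.neg (neg_nonneg.2 ht) x y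

theorem lipschitzWith_left (hφ : IsGlobalFlow Y φ) {L : ℝ≥0} (hL : ∀ x, ‖Y x‖ ≤ L) (x : E) :
    LipschitzWith L (fun t => φ t x) :=
  lipschitzWith_of_nnnorm_deriv_le (fun t => (hφ.hasDerivAt x t).differentiableAt) fun t => by
    rw [(hφ.hasDerivAt x t).deriv]
    exact hL _

theorem continuous_uncurry (hφ : IsGlobalFlow Y φ) (hY : LipschitzWith K Y) {L : ℝ≥0}
    (hL : ∀ x, ‖Y x‖ ≤ L) : Continuous (fun p : ℝ × E => φ p.1 p.2) := by
  exact continuous_prod_of_continuous_lipschitzWith (fun p : ℝ × E => φ p.1 p.2) L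
    (fun t => (hφ.lipschitzWith hY t).continuous) (fun x => hφ.lipschitzWith_left hL x)

variable [FiniteDimensional ℝ E] [MeasurableSpace E] [BorelSpace E]

/-- If `ν` is infinitesimally invariant under a bounded Lipschitz vector field, then
integrals of bounded Lipschitz functions are invariant under its flow. -/
theorem integral_comp_eq (hφ : IsGlobalFlow Y φ) (hY : LipschitzWith K Y) {L : ℝ≥0}
    (hL : ∀ x, ‖Y x‖ ≤ L) {m ν : Measure E} [m.IsAddHaarMeasure] [IsFiniteMeasure ν]
    (hν : ν ≪ m)
    (hdiv : ∀ (g : E → ℝ) (C : ℝ≥0), LipschitzWith C g → ∫ x, fderiv ℝ g x (Y x) ∂ν = 0)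
    {f : E → ℝ} {C : ℝ≥0} (hf : LipschitzWith C f) {B : ℝ} (hB : ∀ x, ‖f x‖ ≤ B) (t : ℝ) :
    ∫ x, f (φ t x) ∂ν = ∫ x, f x ∂ν := by
  have hd : ∀ t, HasDerivAt (fun s => ∫ x, f (φ s x) ∂ν) 0 t := by
    intro t
    set g : E → ℝ := fun x => f (φ t x) with hg
    have hgl : LipschitzWith (C * (Real.exp (K * |t|)).toNNReal) g :=
      hf.comp (hφ.lipschitzWith hY t)
    set D := C * (Real.exp (K * |t|)).toNNReal
    have hmeas : ∀ s, AEStronglyMeasurable (fun x => g (φ s x)) ν := fun s =>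
      (hgl.continuous.comp (hφ.lipschitzWith hY s).continuous).aestronglyMeasurable
    have h0 : HasDerivAt (fun s => ∫ x, g (φ s x) ∂ν) 0 0 := by
      suffices HasDerivAt (fun s => ∫ x, g (φ s x) ∂ν) (∫ x, fderiv ℝ g x (Y x) ∂ν) 0 by
        rwa [hdiv g _ hgl] at this
      refine (hasDerivAt_integral_of_dominated_loc_of_lip (F := fun s x => g (φ s x))
        (s := univ) (bound := fun _ => (D * L : ℝ≥0)) univ_mem
        (.of_forall hmeas) ?_ ?_ ?_ ?_ ?_).2
      · refine Integrable.of_bound (hmeas 0) B (.of_forall fun x => hB _)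
      · exact ((isBoundedBilinearMap_apply (𝕜 := ℝ) (E := E) (F := ℝ)).continuous.measurable.comp
          ((measurable_fderiv ℝ g).prodMk hY.continuous.measurable)).aestronglyMeasurable
      · refine .of_forall fun x => ?_
        have := (hgl.comp (hφ.lipschitzWith_left hL x)).lipschitzOnWith (s := univ)
        have hn : Real.nnabs ((D * L : ℝ≥0) : ℝ) = D * L := by ext; simp
        rw [hn]
        exact this
      · exact integrable_const _
      · filter_upwards [hν.ae_le (hgl.ae_differentiableAt (μ := m))] with x hx
        have h1 := hφ.hasDerivAt x 0
        rw [hφ.map_zero] at h1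
        have h2 : HasFDerivAt g (fderiv ℝ g x) (φ 0 x) := by
          rw [hφ.map_zero]; exact hx.hasFDerivAt
        exact HasFDerivAt.comp_hasDerivAt (l := g) (f := fun s => φ s x) (0 : ℝ) h2 h1
    have h1 := HasDerivAt.comp_sub_const (f := fun s => ∫ x, g (φ s x) ∂ν) t t (by simpa using h0)
    refine h1.congr_of_eventuallyEq (.of_forall fun s => ?_)
    simp only [hg, ← hφ.map_add hY]
    simp
  have := is_const_of_deriv_eq_zero (fun t => (hd t).differentiableAt)
    (fun t => (hd t).deriv) t 0
  simpa [hφ.map_zero] using this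

end IsGlobalFlow

/-- Finite measures are determined by the integrals of bounded Lipschitz functions. -/
theorem ext_of_forall_lipschitz_integral_eq {Ω : Type*} [MeasurableSpace Ω] [PseudoEMetricSpace Ω]
    [BorelSpace Ω] {μ ν : Measure Ω} [IsProbabilityMeasure μ] [IsProbabilityMeasure ν]
    (h : ∀ (f : Ω → ℝ) (C : ℝ≥0) (B : ℝ), LipschitzWith C f → (∀ x, ‖f x‖ ≤ B) →
      ∫ x, f x ∂μ = ∫ x, f x ∂ν) : μ = ν := by
  let μ' : ProbabilityMeasure Ω := ⟨μ, inferInstance⟩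
  let ν' : ProbabilityMeasure Ω := ⟨ν, inferInstance⟩
  have key : Tendsto (fun _ : ℕ => μ') atTop (𝓝 ν') := by
    rw [tendsto_iff_forall_lipschitz_integral_tendsto]
    rintro f ⟨C, hC⟩ ⟨L, hL⟩
    rcases isEmpty_or_nonempty Ω with hΩ | ⟨⟨x₀⟩⟩
    · have hf : f = 0 := Subsingleton.elim _ _
      simp [hf]
    have := h f L (|f x₀| + C) hL fun x => by
      have := hC x x₀
      rw [Real.dist_eq] at this
      rw [Real.norm_eq_abs]
      calc |f x| = |f x₀ + (f x - f x₀)| := by ring_nf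
        _ ≤ |f x₀| + |f x - f x₀| := abs_add_le _ _
        _ ≤ _ := by gcongr
    exact tendsto_const_nhds.congr' (.of_forall fun _ => this.symm)
  rw [ProbabilityMeasure.tendsto_iff_forall_integral_tendsto] at key
  refine ext_of_forall_integral_eq_of_IsFiniteMeasure fun f => ?_
  exact tendsto_nhds_unique tendsto_const_nhds (key f)

end Flow

section Truncation

variable (F : Finset ℤ)

/-- Extension of a finite configuration by zero to all of `ℤ`. -/
def zeroExt (x : F → ℂ) (n : ℤ) : ℂ := if h : n ∈ F then x ⟨n, h⟩ else 0

/-- The sum of the two neighbouring values, with zero boundary conditions. -/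
def nbrSum (x : F → ℂ) (n : ℤ) : ℂ := zeroExt F x (n + 1) + zeroExt F x (n - 1)

/-- The Ablowitz–Ladik vector field with zero boundary conditions outside `F`. -/
def alField (x : F → ℂ) (n : F) : ℂ :=
  Complex.I * ((1 + (Complex.normSq (x n) : ℂ)) * nbrSum F x n - 2 * x n)

/-- The multiplicative form of the conserved quantity `∑ log (1 + |xₙ|²)`. -/
def alMass (x : F → ℂ) : ℝ := ∏ n, (1 + Complex.normSq (x n))

variable {F}

@[simp] theorem zeroExt_coe (x : F → ℂ) (n : F) : zeroExt F x n = x n := by simp [zeroExt]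

theorem zeroExt_of_notMem (x : F → ℂ) {n : ℤ} (h : n ∉ F) : zeroExt F x n = 0 := by
  simp [zeroExt, h]

theorem contDiff_zeroExt (n : ℤ) : ContDiff ℝ 1 (fun x : F → ℂ => zeroExt F x n) := by
  by_cases h : n ∈ F
  · simp only [zeroExt, h, dite_true]; fun_prop
  · simp only [zeroExt, h, dite_false]; fun_prop

theorem zeroExt_add_smul_single (x : F → ℂ) (n : F) (z : ℂ) (t : ℝ) {k : ℤ} (hk : k ≠ n) :
    zeroExt F (x + t • (Pi.single n z : F → ℂ)) k = zeroExt F x k := by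
  by_cases h : k ∈ F
  · have : (⟨k, h⟩ : F) ≠ n := fun e => hk (by rw [← e])
    simp [zeroExt, h, this]
  · simp [zeroExt, h]

theorem nbrSum_add_smul_single (x : F → ℂ) (n : F) (z : ℂ) (t : ℝ) :
    nbrSum F (x + t • (Pi.single n z : F → ℂ)) n = nbrSum F x n := by
  unfold nbrSum
  rw [zeroExt_add_smul_single _ _ _ _ (by omega), zeroExt_add_smul_single _ _ _ _ (by omega)]

theorem sum_im_conj_mul_nbrSum (x : F → ℂ) :
    ∑ n : F, ((starRingEnd ℂ) (x n) * nbrSum F x n).im = 0 := by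
  have h1 : ∀ k : ℤ, ∑ n : F, ((starRingEnd ℂ) (x n) * zeroExt F x (n + k)).im
      = ∑' n : ℤ, ((starRingEnd ℂ) (zeroExt F x n) * zeroExt F x (n + k)).im := by
    intro k
    rw [tsum_eq_sum (s := F) fun n hn => by simp [zeroExt_of_notMem x hn],
      ← Finset.sum_coe_sort F]
    simp
  have h2 : ∑' n : ℤ, ((starRingEnd ℂ) (zeroExt F x n) * zeroExt F x (n + -1)).im
      = -∑' n : ℤ, ((starRingEnd ℂ) (zeroExt F x n) * zeroExt F x (n + 1)).im := by
    rw [← (Equiv.addRight (1 : ℤ)).tsum_eq, ← tsum_neg]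
    refine tsum_congr fun n => ?_
    simp only [Equiv.coe_addRight, add_neg_cancel_right, Complex.mul_im, Complex.conj_re,
      Complex.conj_im]
    ring
  simp only [nbrSum, mul_add, Complex.add_im, Finset.sum_add_distrib]
  have h3 := h1 (-1)
  rw [h2, ← h1 1] at h3
  simp only [← sub_eq_add_neg] at h3
  rw [h3]
  ring

theorem one_le_one_add_normSq (z : ℂ) : 1 ≤ 1 + Complex.normSq z := by
  linarith [Complex.normSq_nonneg z]

theorem one_le_alMass (x : F → ℂ) : 1 ≤ alMass F x :=
  Finset.prod_induction _ (fun a : ℝ => 1 ≤ a) (fun _ _ => one_le_mul_of_one_le_of_one_le)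
    le_rfl fun n _ => one_le_one_add_normSq (x n)

theorem alMass_pos (x : F → ℂ) : 0 < alMass F x := one_pos.trans_le (one_le_alMass x)

theorem contDiff_alMass : ContDiff ℝ 1 (alMass F) := by
  unfold alMass
  simp only [Complex.normSq_eq_norm_sq]
  exact contDiff_prod fun n _ => contDiff_const.add ((contDiff_apply ℝ ℂ n).norm_sq ℝ)

theorem contDiff_alField : ContDiff ℝ 1 (alField F) := by
  rw [contDiff_pi]
  intro n
  have h1 := contDiff_zeroExt (F := F) (n + 1)
  have h2 := contDiff_zeroExt (F := F) (n - 1)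
  have h3 : ContDiff ℝ 1 fun x : F → ℂ => x n := contDiff_apply ℝ ℂ n
  have h4 : ContDiff ℝ 1 fun x : F → ℂ => (Complex.normSq (x n) : ℂ) := by
    simp only [Complex.normSq_eq_norm_sq]
    exact Complex.ofRealCLM.contDiff.comp (h3.norm_sq ℝ)
  exact contDiff_const.mul (((contDiff_const.add h4).mul (h1.add h2)).sub (contDiff_const.mul h3))

theorem alMass_eq_prod_erase_mul (x : F → ℂ) (n : F) :
    alMass F x = (∏ m ∈ Finset.univ.erase n, (1 + Complex.normSq (x m)))
        * (1 + Complex.normSq (x n)) :=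
  (Finset.prod_erase_mul _ _ (Finset.mem_univ n)).symm

theorem one_le_prod_erase (x : F → ℂ) (n : F) :
    1 ≤ ∏ m ∈ Finset.univ.erase n, (1 + Complex.normSq (x m)) :=
  Finset.prod_induction _ (fun a : ℝ => 1 ≤ a) (fun _ _ => one_le_mul_of_one_le_of_one_le)
    le_rfl fun m _ => one_le_one_add_normSq (x m)

theorem norm_le_alMass (x : F → ℂ) : ‖x‖ ≤ alMass F x := by
  refine (pi_norm_le_iff_of_nonneg (alMass_pos x).le).2 fun n => ?_
  rw [alMass_eq_prod_erase_mul x n]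
  have h := one_le_prod_erase x n
  have h2 : ‖x n‖ ≤ 1 + Complex.normSq (x n) := by
    rw [Complex.normSq_eq_norm_sq]; nlinarith [sq_nonneg (‖x n‖ - 1), norm_nonneg (x n)]
  nlinarith [one_le_one_add_normSq (x n)]

section Field

variable {G : ℝ → ℝ} {R : ℝ}

theorem contDiff_smul_alField (hG : ∀ m > 0, ContDiffAt ℝ 1 G m) :
    ContDiff ℝ 1 (fun x : F → ℂ => G (alMass F x) • alField F x) := by
  have h : ContDiff ℝ 1 fun x : F → ℂ => G (alMass F x) := contDiff_iff_contDiffAt.2 fun x =>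
    (hG _ (alMass_pos x)).comp x contDiff_alMass.contDiffAt
  exact h.smul contDiff_alField

theorem hasCompactSupport_smul_alField (hG0 : ∀ m ≥ R, G m = 0) :
    HasCompactSupport (fun x : F → ℂ => G (alMass F x) • alField F x) := by
  refine HasCompactSupport.intro (isCompact_closedBall (0 : F → ℂ) R) fun x hx => ?_
  rw [mem_closedBall_zero_iff, not_le] at hx
  simp [hG0 _ (hx.le.trans (norm_le_alMass x))]

theorem alMass_add_smul_single (x : F → ℂ) (n : F) (z : ℂ) (t : ℝ) :
    alMass F (x + t • (Pi.single n z : F → ℂ))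
      = (∏ m ∈ Finset.univ.erase n, (1 + Complex.normSq (x m)))
        * (1 + Complex.normSq (x n + t * z)) := by
  unfold alMass
  rw [← Finset.prod_erase_mul _ _ (Finset.mem_univ n)]
  congr 1
  · refine Finset.prod_congr rfl fun m hm => ?_
    simp [Finset.ne_of_mem_erase hm]
  · simp

/-- The contribution of one site to the divergence of `G(mass) • alField`. -/
theorem lineDeriv_smul_alField_site (hG : ∀ m > 0, ContDiffAt ℝ 1 G m) (x : F → ℂ) (n : F) :
    lineDeriv ℝ (fun y : F → ℂ => (G (alMass F y) • alField F y n).re) x (Pi.single n 1)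
      + lineDeriv ℝ (fun y : F → ℂ => (G (alMass F y) • alField F y n).im) x
          (Pi.single n Complex.I)
      = -2 * (G (alMass F x) + alMass F x * deriv G (alMass F x))
          * ((starRingEnd ℂ) (x n) * nbrSum F x n).im := by
  set P := ∏ m ∈ Finset.univ.erase n, (1 + Complex.normSq (x m))
  set b := nbrSum F x n with hb
  set u := (x n).re with hu
  set v := (x n).im with hv
  have hm : alMass F x = P * (1 + (u ^ 2 + v ^ 2)) := by
    rw [alMass_eq_prod_erase_mul x n, Complex.normSq_apply]; ring
  have hP : ∀ (z : ℂ) (t : ℝ), alMass F (x + t • (Pi.single n z : F → ℂ))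
      = P * (1 + Complex.normSq (x n + t * z)) := fun z t => alMass_add_smul_single x n z t
  clear_value P
  have hGd : HasDerivAt G (deriv G (alMass F x)) (P * (1 + (u ^ 2 + v ^ 2))) := by
    rw [← hm]
    exact ((hG _ (by linarith [one_le_alMass x])).differentiableAt one_ne_zero).hasDerivAt
  have hid : HasDerivAt (fun t : ℝ => t) 1 0 := hasDerivAt_id 0
  have h1 : HasLineDerivAt ℝ (fun y : F → ℂ => (G (alMass F y) • alField F y n).re)
      (deriv G (alMass F x) * (P * (2 * u)) * (-(1 + (u ^ 2 + v ^ 2)) * b.im + 2 * v)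
        + G (alMass F x) * (-(2 * u) * b.im)) x (Pi.single n 1) := by
    have hu' : HasDerivAt (fun t : ℝ => (u + t) ^ 2 + v ^ 2) (2 * u) 0 := by
      simpa using ((hid.const_add u).pow 2).add_const (v ^ 2)
    have hG' : HasDerivAt (fun t : ℝ => G (P * (1 + ((u + t) ^ 2 + v ^ 2))))
        (deriv G (alMass F x) * (P * (2 * u))) 0 :=
      HasDerivAt.comp (0 : ℝ) (by simpa using hGd) ((hu'.const_add 1).const_mul P)
    have hA : HasDerivAt (fun t : ℝ => -(1 + ((u + t) ^ 2 + v ^ 2)) * b.im + 2 * v)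
        (-(2 * u) * b.im) 0 :=
      (((hu'.const_add 1).neg).mul_const b.im).add_const (2 * v)
    have := hG'.mul hA
    unfold HasLineDerivAt
    convert! this using 1
    · funext t
      simp only [hP, alField, nbrSum_add_smul_single, ← hb]
      simp [Complex.normSq_apply, ← hu, ← hv]
      ring_nf
    · rw [hm]; simp
  have h2 : HasLineDerivAt ℝ (fun y : F → ℂ => (G (alMass F y) • alField F y n).im)
      (deriv G (alMass F x) * (P * (2 * v)) * ((1 + (u ^ 2 + v ^ 2)) * b.re - 2 * u)
        + G (alMass F x) * ((2 * v) * b.re)) x (Pi.single n Complex.I) := by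
    have hu' : HasDerivAt (fun t : ℝ => u ^ 2 + (v + t) ^ 2) (2 * v) 0 := by
      simpa using ((hid.const_add v).pow 2).const_add (u ^ 2)
    have hG' : HasDerivAt (fun t : ℝ => G (P * (1 + (u ^ 2 + (v + t) ^ 2))))
        (deriv G (alMass F x) * (P * (2 * v))) 0 :=
      HasDerivAt.comp (0 : ℝ) (by simpa using hGd) ((hu'.const_add 1).const_mul P)
    have hA : HasDerivAt (fun t : ℝ => (1 + (u ^ 2 + (v + t) ^ 2)) * b.re - 2 * u)
        ((2 * v) * b.re) 0 :=
      ((hu'.const_add 1).mul_const b.re).sub_const (2 * u)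
    have := hG'.mul hA
    unfold HasLineDerivAt
    convert! this using 1
    · funext t
      simp only [hP, alField, nbrSum_add_smul_single, ← hb]
      simp [Complex.normSq_apply, ← hu, ← hv]
      ring_nf
    · rw [hm]; simp
  rw [h1.lineDeriv, h2.lineDeriv]
  simp only [Complex.mul_im, Complex.conj_re, Complex.conj_im, ← hu, ← hv, hm]
  ring

end Field
end Truncation

section Divergence

variable {F : Finset ℤ} {G : ℝ → ℝ} {R : ℝ}

theorem eq_sum_single_re_im (w : F → ℂ) :
    w = ∑ n, ((w n).re • (Pi.single n 1 : F → ℂ) + (w n).im • (Pi.single n Complex.I : F → ℂ)) := by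
  funext k
  rw [Finset.sum_apply, Finset.sum_eq_single k]
  · simp
  · intro n _ hn
    simp [Pi.single_eq_of_ne (Ne.symm hn)]
  · simp

theorem integral_lineDeriv_mul_eq_neg {E : Type*} [NormedAddCommGroup E] [NormedSpace ℝ E]
    [MeasurableSpace E] [BorelSpace E] [FiniteDimensional ℝ E] {m : Measure E}
    [m.IsAddHaarMeasure] {g h : E → ℝ} {C : ℝ≥0} (hg : LipschitzWith C g) (hh : ContDiff ℝ 1 h)
    (hc : HasCompactSupport h) (v : E) :
    Integrable (fun x => lineDeriv ℝ g x v * h x) m ∧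
    Integrable (fun x => lineDeriv ℝ h x v * g x) m ∧
    ∫ x, lineDeriv ℝ g x v * h x ∂m = -∫ x, lineDeriv ℝ h x v * g x ∂m := by
  obtain ⟨D, hD⟩ : ∃ D, LipschitzWith D h := hh.lipschitzWith_of_hasCompactSupport hc one_ne_zero
  refine ⟨?_, ?_, ?_⟩
  · exact (hh.continuous.integrable_of_hasCompactSupport hc).bdd_mul
      (aestronglyMeasurable_lineDeriv hg.continuous m)
      (c := C * ‖v‖) (Eventually.of_forall fun x => norm_lineDeriv_le_of_lipschitz ℝ hg)
  · have h1 : (fun x => lineDeriv ℝ h x v) = fun x => fderiv ℝ h x v :=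
      funext fun x => (hh.differentiable one_ne_zero x).lineDeriv_eq_fderiv
    have h2 : Continuous fun x => fderiv ℝ h x v :=
      (hh.continuous_fderiv one_ne_zero).clm_apply continuous_const
    have h3 : HasCompactSupport fun x => lineDeriv ℝ h x v := by
      rw [h1]; exact hc.fderiv_apply (𝕜 := ℝ) v
    exact ((h1 ▸ h2).mul hg.continuous).integrable_of_hasCompactSupport h3.mul_right
  · rw [hg.integral_lineDeriv_mul_eq hD hc v, ← integral_neg]
    simp only [lineDeriv_neg, neg_mul]

/-- Functions of the mass times the Ablowitz–Ladik field are divergence free, in weak form. -/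
theorem integral_fderiv_smul_alField (hG : ∀ m > 0, ContDiffAt ℝ 1 G m)
    (hG0 : ∀ m ≥ R, G m = 0) {g : (F → ℂ) → ℝ} {C : ℝ≥0} (hg : LipschitzWith C g) :
    ∫ x, fderiv ℝ g x (G (alMass F x) • alField F x) = 0 := by
  have hW := contDiff_smul_alField (F := F) hG
  have hWc := hasCompactSupport_smul_alField (F := F) hG0
  set W : (F → ℂ) → F → ℂ := fun x => G (alMass F x) • alField F x with hWdef
  have hre : ∀ n : F, ContDiff ℝ 1 fun x => (W x n).re := fun n =>
    Complex.reCLM.contDiff.comp (contDiff_pi.1 hW n)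
  have him : ∀ n : F, ContDiff ℝ 1 fun x => (W x n).im := fun n =>
    Complex.imCLM.contDiff.comp (contDiff_pi.1 hW n)
  have hrec : ∀ n : F, HasCompactSupport fun x => (W x n).re := fun n =>
    hWc.comp_left (g := fun w : F → ℂ => (w n).re) (by simp)
  have himc : ∀ n : F, HasCompactSupport fun x => (W x n).im := fun n =>
    hWc.comp_left (g := fun w : F → ℂ => (w n).im) (by simp)
  have h1 : ∀ᵐ x, fderiv ℝ g x (W x) = ∑ n : F, (lineDeriv ℝ g x (Pi.single n 1) * (W x n).re
      + lineDeriv ℝ g x (Pi.single n Complex.I) * (W x n).im) := by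
    filter_upwards [hg.ae_differentiableAt (μ := volume)] with x hx
    conv_lhs => rw [eq_sum_single_re_im (W x)]
    simp only [map_sum, map_add, map_smul, hx.lineDeriv_eq_fderiv, smul_eq_mul, mul_comm]
  rw [integral_congr_ae h1]
  have hA := fun n : F => integral_lineDeriv_mul_eq_neg (m := (volume : Measure (F → ℂ))) hg
    (hre n) (hrec n) (Pi.single n 1)
  have hB := fun n : F => integral_lineDeriv_mul_eq_neg (m := (volume : Measure (F → ℂ))) hg
    (him n) (himc n) (Pi.single n Complex.I)
  have hAB : ∀ n ∈ (Finset.univ : Finset F), Integrable (fun x =>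
      lineDeriv ℝ g x (Pi.single n 1) * (W x n).re
        + lineDeriv ℝ g x (Pi.single n Complex.I) * (W x n).im) := fun n _ =>
    (hA n).1.add (hB n).1
  have hAB' : ∀ n ∈ (Finset.univ : Finset F), Integrable (fun x =>
      lineDeriv ℝ (fun y => (W y n).re) x (Pi.single n 1) * g x
        + lineDeriv ℝ (fun y => (W y n).im) x (Pi.single n Complex.I) * g x) := fun n _ =>
    (hA n).2.1.add (hB n).2.1
  rw [integral_finsetSum _ hAB]
  have h2 : ∀ n : F, ∫ x, (lineDeriv ℝ g x (Pi.single n 1) * (W x n).re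
      + lineDeriv ℝ g x (Pi.single n Complex.I) * (W x n).im)
      = -∫ x, (lineDeriv ℝ (fun y => (W y n).re) x (Pi.single n 1) * g x
        + lineDeriv ℝ (fun y => (W y n).im) x (Pi.single n Complex.I) * g x) := by
    intro n
    rw [integral_add (hA n).1 (hB n).1, integral_add (hA n).2.1 (hB n).2.1, (hA n).2.2,
      (hB n).2.2]
    ring
  rw [Finset.sum_congr rfl fun n _ => h2 n, Finset.sum_neg_distrib,
    ← integral_finsetSum _ hAB', neg_eq_zero]
  refine integral_eq_zero_of_ae (Eventually.of_forall fun x => ?_)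
  simp only [Pi.zero_apply, ← add_mul, ← Finset.sum_mul]
  have h3 : ∀ n : F, lineDeriv ℝ (fun y => (W y n).re) x (Pi.single n 1)
      + lineDeriv ℝ (fun y => (W y n).im) x (Pi.single n Complex.I)
      = -2 * (G (alMass F x) + alMass F x * deriv G (alMass F x))
          * ((starRingEnd ℂ) (x n) * nbrSum F x n).im := fun n =>
    lineDeriv_smul_alField_site hG x n
  rw [Finset.sum_congr rfl fun n _ => h3 n, ← Finset.mul_sum, sum_im_conj_mul_nbrSum]
  simp

end Divergence

section Density

theorem MeasureTheory.Measure.pi_withDensity_ofReal {ι E : Type*} [Fintype ι] [MeasurableSpace E]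
    (m : Measure E) [SigmaFinite m] {f : E → ℝ} (hf : Integrable f m)
    (h0 : ∀ x, 0 ≤ f x) :
    Measure.pi (fun _ : ι => m.withDensity fun x => ENNReal.ofReal (f x))
      = (Measure.pi fun _ : ι => m).withDensity fun x => ENNReal.ofReal (∏ i, f (x i)) := by
  refine Measure.pi_eq fun s hs => ?_
  rw [withDensity_apply _ (MeasurableSet.univ_pi hs), Measure.restrict_pi_pi,
    ← ofReal_integral_eq_lintegral_ofReal
      (Integrable.fintype_prod_dep fun i => hf.restrict)
      (Eventually.of_forall fun x => Finset.prod_nonneg fun i _ => h0 _),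
    integral_fintype_prod_eq_prod (μ := fun i => m.restrict (s i)) (fun _ => f),
    ENNReal.ofReal_prod_of_nonneg fun i _ => integral_nonneg h0]
  refine Finset.prod_congr rfl fun i _ => ?_
  rw [withDensity_apply _ (hs i), ofReal_integral_eq_lintegral_ofReal hf.restrict
    (Eventually.of_forall h0)]

theorem integrable_of_isFiniteMeasure_withDensity_ofReal {E : Type*} [MeasurableSpace E]
    {m : Measure E} {f : E → ℝ} (hfm : Measurable f) (h0 : ∀ x, 0 ≤ f x)
    [h : IsFiniteMeasure (m.withDensity fun x => ENNReal.ofReal (f x))] : Integrable f m := by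
  refine ⟨hfm.aestronglyMeasurable, ?_⟩
  rw [hasFiniteIntegral_iff_ofReal (Eventually.of_forall h0)]
  simpa [withDensity_apply _ MeasurableSet.univ] using
    measure_lt_top (m.withDensity fun x => ENNReal.ofReal (f x)) univ

/-- The density of `muBeta β` as a function of `1 + |z|²`. -/
def siteDensity (β : ℝ) (m : ℝ) : ℝ := (1 + 2 * β) / Real.pi * m ^ (-(2 + 2 * β))

theorem muBeta_eq (β : ℝ) : muBeta β
    = volume.withDensity fun z => ENNReal.ofReal (siteDensity β (1 + Complex.normSq z)) := by
  unfold muBeta siteDensity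
  congr 1
  funext z
  rw [Real.rpow_neg (by linarith [one_le_one_add_normSq z]), div_mul_eq_div_div, div_eq_mul_inv]

theorem measurable_siteDensity (β : ℝ) : Measurable (siteDensity β) :=
  measurable_const.mul (measurable_id.pow_const _)

theorem siteDensity_nonneg {β : ℝ} (hβ : 0 < β) {m : ℝ} (hm : 0 ≤ m) : 0 ≤ siteDensity β m := by
  unfold siteDensity
  have := Real.pi_pos
  have := Real.rpow_nonneg hm (-(2 + 2 * β))
  positivity

theorem pi_muBeta_eq {β : ℝ} (hβ : 0 < β) [IsProbabilityMeasure (muBeta β)] (F : Finset ℤ) :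
    Measure.pi (fun _ : F => muBeta β) = volume.withDensity fun x : F → ℂ =>
      ENNReal.ofReal (((1 + 2 * β) / Real.pi) ^ F.card * alMass F x ^ (-(2 + 2 * β))) := by
  have h0 : ∀ z, 0 ≤ siteDensity β (1 + Complex.normSq z) := fun z =>
    siteDensity_nonneg hβ (by linarith [one_le_one_add_normSq z])
  have hm : Measurable fun z : ℂ => siteDensity β (1 + Complex.normSq z) :=
    (measurable_siteDensity β).comp (by
      simp only [Complex.normSq_eq_norm_sq]; fun_prop)
  have : IsFiniteMeasure ((volume : Measure ℂ).withDensity fun z =>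
      ENNReal.ofReal (siteDensity β (1 + Complex.normSq z))) := by
    rw [← muBeta_eq]; infer_instance
  rw [muBeta_eq, Measure.pi_withDensity_ofReal _
    (integrable_of_isFiniteMeasure_withDensity_ofReal hm h0) h0, volume_pi]
  congr 1
  funext x
  simp only [siteDensity, Finset.prod_mul_distrib, Finset.prod_const, alMass]
  rw [Real.finsetProd_rpow _ _ fun n _ => by linarith [one_le_one_add_normSq (x n)]]
  simp

end Density

section TruncatedFlow

variable {F : Finset ℤ}

theorem hasDerivAt_alMass {x : ℝ → F → ℂ} {t c : ℝ} (h : HasDerivAt x (c • alField F (x t)) t) :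
    HasDerivAt (fun s => alMass F (x s)) 0 t := by
  have h1 : ∀ n : F, HasDerivAt (fun s => 1 + Complex.normSq (x s n))
      (-2 * c * (1 + Complex.normSq (x t n))
        * ((starRingEnd ℂ) (x t n) * nbrSum F (x t) n).im) t := by
    intro n
    have hn : HasDerivAt (fun s => x s n) (c • alField F (x t) n) t := hasDerivAt_pi.1 h n
    have hre := Complex.reCLM.hasFDerivAt.comp_hasDerivAt t hn
    have him := Complex.imCLM.hasFDerivAt.comp_hasDerivAt t hn
    have := ((hre.mul hre).add (him.mul him)).const_add 1
    convert! this using 1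
    simp [alField, Complex.normSq_apply]
    ring
  have h2 := HasDerivAt.finsetProd (u := Finset.univ) fun n _ => h1 n
  convert! h2 using 1
  · funext s
    simp [alMass]
  have h3 : ∀ n : F, (∏ j ∈ Finset.univ.erase n, (1 + Complex.normSq (x t j)))
      • (-2 * c * (1 + Complex.normSq (x t n))
        * ((starRingEnd ℂ) (x t n) * nbrSum F (x t) n).im)
      = -2 * c * alMass F (x t) * ((starRingEnd ℂ) (x t n) * nbrSum F (x t) n).im := by
    intro n
    rw [alMass_eq_prod_erase_mul (x t) n, smul_eq_mul]
    ring
  rw [Finset.sum_congr rfl fun n _ => h3 n, ← Finset.mul_sum, sum_im_conj_mul_nbrSum, mul_zero]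

/-- On any finite box there is a flow preserving the product measure which follows the
Ablowitz–Ladik equation with zero boundary conditions on a prescribed sublevel set of the mass. -/
theorem exists_truncated_flow {β : ℝ} (hβ : 0 < β) [IsProbabilityMeasure (muBeta β)]
    (F : Finset ℤ) (R : ℝ) :
    ∃ φ : ℝ → (F → ℂ) → (F → ℂ), Continuous (fun p : ℝ × (F → ℂ) => φ p.1 p.2) ∧
      (∀ x, φ 0 x = x) ∧
      (∀ t, (Measure.pi fun _ : F => muBeta β).map (φ t) = Measure.pi fun _ : F => muBeta β) ∧
      ∀ x, alMass F x ≤ R → ∀ t, HasDerivAt (fun s => φ s x) (alField F (φ t x)) t := by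
  set χ : ℝ → ℝ := fun m => Real.smoothTransition (R + 1 - m) with hχdef
  have hχ : ContDiff ℝ 1 χ := Real.smoothTransition.contDiff.comp (contDiff_const.sub contDiff_id)
  have hχ0 : ∀ m ≥ R + 1, χ m = 0 := fun m hm =>
    Real.smoothTransition.zero_of_nonpos (by linarith)
  have hχ1 : ∀ m ≤ R, χ m = 1 := fun m hm => Real.smoothTransition.one_of_one_le (by linarith)
  set Y : (F → ℂ) → F → ℂ := fun x => χ (alMass F x) • alField F x with hYdef
  have hYs : ContDiff ℝ 1 Y := contDiff_smul_alField fun m _ => hχ.contDiffAt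
  have hYc : HasCompactSupport Y := hasCompactSupport_smul_alField hχ0
  obtain ⟨K, hK⟩ := hYs.lipschitzWith_of_hasCompactSupport hYc one_ne_zero
  obtain ⟨L, hL⟩ : ∃ L : ℝ≥0, ∀ x, ‖Y x‖ ≤ L := by
    obtain ⟨L, hL⟩ := hYc.exists_bound_of_continuous hYs.continuous
    exact ⟨L.toNNReal, fun x => (hL x).trans (Real.le_coe_toNNReal L)⟩
  obtain ⟨φ, hφ⟩ := hK.exists_isGlobalFlow hL
  have hcont := hφ.continuous_uncurry hK hL
  have hct : ∀ t, Continuous (φ t) := fun t => (hφ.lipschitzWith hK t).continuous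
  refine ⟨φ, hcont, hφ.map_zero, fun t => ?_, fun x hx t => ?_⟩
  · have := Measure.isProbabilityMeasure_map (μ := Measure.pi fun _ : F => muBeta β)
      (hct t).aemeasurable
    refine ext_of_forall_lipschitz_integral_eq fun f C B hf hB => ?_
    rw [integral_map (hct t).aemeasurable hf.continuous.aestronglyMeasurable]
    set c : ℝ := ((1 + 2 * β) / Real.pi) ^ F.card with hc
    have hc0 : 0 ≤ c := by have := Real.pi_pos; positivity
    have hdens : Measurable fun x : F → ℂ => c * alMass F x ^ (-(2 + 2 * β)) :=
      (contDiff_alMass.continuous.measurable.pow_const _).const_mul c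
    refine hφ.integral_comp_eq hK hL (m := volume) ?_ (fun g C' hg => ?_) hf hB t
    · rw [pi_muBeta_eq hβ]
      exact withDensity_absolutelyContinuous _ _
    · rw [pi_muBeta_eq hβ, integral_withDensity_eq_integral_toReal_smul hdens.ennreal_ofReal
        (Eventually.of_forall fun _ => ENNReal.ofReal_lt_top)]
      have h := integral_fderiv_smul_alField (F := F) (R := R + 1)
        (G := fun m => c * m ^ (-(2 + 2 * β)) * χ m) (fun m hm =>
          (contDiffAt_const.mul (contDiffAt_id.rpow_const_of_ne hm.ne')).mul hχ.contDiffAt)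
        (fun m hm => by simp [hχ0 m hm]) hg
      rw [← h]
      refine integral_congr_ae (Eventually.of_forall fun x => ?_)
      have hn : 0 ≤ c * alMass F x ^ (-(2 + 2 * β)) :=
        mul_nonneg hc0 (Real.rpow_nonneg (alMass_pos x).le _)
      simp only [ENNReal.toReal_ofReal hn, hYdef, ← map_smul, smul_smul]
  · have hd : ∀ s, HasDerivAt (fun s => alMass F (φ s x)) 0 s := fun s =>
      hasDerivAt_alMass (hφ.hasDerivAt x s)
    have hconst : alMass F (φ t x) = alMass F x := by
      have := is_const_of_deriv_eq_zero (fun s => (hd s).differentiableAt)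
        (fun s => (hd s).deriv) t 0
      simpa [hφ.map_zero] using this
    have := hφ.hasDerivAt x t
    simpa [hYdef, hconst, hχ1 _ hx] using this

end TruncatedFlow

section Gronwall

theorem le_mul_exp_integral_of_abs_deriv_le {g g' a : ℝ → ℝ} {T : ℝ}
    (hg : ∀ t, HasDerivAt g (g' t) t) (ha : Continuous a) (ha0 : ∀ t, 0 ≤ a t)
    (hg0 : ∀ t, 0 ≤ g t) (h : ∀ t ∈ Icc (-T) T, |g' t| ≤ a t * g t) :
    ∀ t ∈ Icc (-T) T, g t ≤ g 0 * Real.exp (∫ s in -T..T, a s) := by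
  have key : ∀ (g g' a : ℝ → ℝ), (∀ t, HasDerivAt g (g' t) t) → Continuous a →
      (∀ t ∈ Icc (-T) T, |g' t| ≤ a t * g t) → ∀ t ∈ Icc 0 T,
      g t ≤ g 0 * Real.exp (∫ s in 0..t, a s) := by
    intro g g' a hg ha h t ht
    have hI : ∀ t, HasDerivAt (fun t => ∫ s in 0..t, a s) (a t) t := fun t =>
      intervalIntegral.integral_hasDerivAt_right (ha.intervalIntegrable _ _)
        (ha.stronglyMeasurableAtFilter _ _) ha.continuousAt
    have hd : ∀ t, HasDerivAt (fun t => g t * Real.exp (-∫ s in 0..t, a s))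
        (g' t * Real.exp (-∫ s in 0..t, a s)
          + g t * (Real.exp (-∫ s in 0..t, a s) * -a t)) t := fun t =>
      (hg t).mul (hI t).neg.exp
    have hanti : AntitoneOn (fun t => g t * Real.exp (-∫ s in 0..t, a s)) (Icc 0 T) := by
      refine antitoneOn_of_deriv_nonpos (convex_Icc 0 T)
        (fun t _ => (hd t).continuousAt.continuousWithinAt)
        (fun t _ => (hd t).differentiableAt.differentiableWithinAt) fun t ht => ?_
      rw [interior_Icc] at ht
      rw [(hd t).deriv]
      have h1 := (abs_le.1 (h t ⟨by linarith [ht.1, ht.2], ht.2.le⟩)).2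
      have h2 := Real.exp_pos (-∫ s in 0..t, a s)
      nlinarith
    have := hanti ⟨le_rfl, ht.1.trans ht.2⟩ ht ht.1
    simp only [intervalIntegral.integral_same, neg_zero, Real.exp_zero, mul_one] at this
    rwa [Real.exp_neg, ← div_eq_mul_inv, div_le_iff₀ (Real.exp_pos _)] at this
  have mono : ∀ a' : ℝ → ℝ, Continuous a' → (∀ t, 0 ≤ a' t) → ∀ t ∈ Icc 0 T,
      ∫ s in 0..t, a' s ≤ ∫ s in -T..T, a' s := fun a' hc hp t ht =>
    intervalIntegral.integral_mono_interval (by linarith [ht.1, ht.2]) ht.1 ht.2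
      (Eventually.of_forall hp) (hc.intervalIntegrable _ _)
  intro t ht
  rcases le_total 0 t with h0 | h0
  · refine (key g g' a hg ha h t ⟨h0, ht.2⟩).trans ?_
    gcongr
    · exact hg0 0
    · exact mono a ha ha0 t ⟨h0, ht.2⟩
  · have ht' : -t ∈ Icc 0 T := ⟨neg_nonneg.2 h0, neg_le.1 ht.1⟩
    have h1 := key (fun t => g (-t)) (fun t => -g' (-t)) (fun t => a (-t))
      (fun t => by simpa [Function.comp_def] using (hg (-t)).scomp t (hasDerivAt_neg t))
      (ha.comp continuous_neg)
      (fun s hs => by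
        rw [abs_neg]
        exact h (-s) ⟨neg_le_neg hs.2, neg_le.1 hs.1⟩) (-t) ht'
    simp only [neg_neg, neg_zero] at h1
    refine h1.trans ?_
    gcongr
    · exact hg0 0
    · refine (mono _ (ha.comp continuous_neg) (fun s => ha0 _) (-t) ht').trans_eq ?_
      simp

end Gronwall

section Jap

theorem jap_le_jap_add_one {m n : ℤ} (h : |m - n| ≤ 1) : jap m ≤ jap n + 1 := by
  have h1 : |(m : ℝ)| ≤ |(n : ℝ)| + 1 := by
    have : |(m : ℝ) - n| ≤ 1 := by exact_mod_cast h
    have h3 := abs_sub_abs_le_abs_sub (m : ℝ) n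
    linarith
  have h2 : |(n : ℝ)| ≤ jap n := Real.abs_le_sqrt (by linarith)
  have h4 : jap n ^ 2 = 1 + (n : ℝ) ^ 2 := Real.sq_sqrt (by positivity)
  refine Real.sqrt_le_left (by linarith [abs_nonneg (n : ℝ)]) |>.2 ?_
  nlinarith [sq_abs (m : ℝ), sq_abs (n : ℝ), abs_nonneg (m : ℝ), abs_nonneg (n : ℝ)]

theorem abs_le_jap (n : ℤ) : |(n : ℝ)| ≤ jap n := Real.abs_le_sqrt (by linarith)

theorem one_le_jap (n : ℤ) : 1 ≤ jap n :=
  Real.one_le_sqrt.2 (by linarith [sq_nonneg (n : ℝ)])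

theorem jap_le_of_abs_le {n : ℤ} {N : ℝ} (h : |(n : ℝ)| ≤ N) : jap n ≤ N + 1 := by
  have := abs_nonneg (n : ℝ)
  refine Real.sqrt_le_left (by linarith) |>.2 ?_
  nlinarith [sq_abs (n : ℝ)]

theorem exp_neg_jap_le {c : ℝ} (hc : 0 < c) {m n : ℤ} (h : |m - n| ≤ 1) :
    Real.exp (-(c * jap n)) ≤ Real.exp c * Real.exp (-(c * jap m)) := by
  rw [← Real.exp_add, Real.exp_le_exp]
  nlinarith [jap_le_jap_add_one h]

end Jap

section Shift

theorem sum_Icc_add_one_le {U : ℤ → ℝ} (hU : ∀ n, 0 ≤ U n) (N : ℤ) :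
    ∑ n ∈ Finset.Icc (-N) N, U (n + 1) ≤ ∑ n ∈ Finset.Icc (-N) N, U n + U (N + 1) := by
  have h := Finset.sum_map (Finset.Icc (-N) N) (Equiv.addRight (1 : ℤ)).toEmbedding U
  simp only [Equiv.toEmbedding_apply, Equiv.coe_addRight] at h
  rw [← h, add_comm, ← Finset.sum_insert (s := Finset.Icc (-N) N) (a := N + 1) (by simp)]
  refine Finset.sum_le_sum_of_subset_of_nonneg (fun k hk => ?_) fun _ _ _ => hU _
  simp only [Finset.mem_map, Finset.mem_Icc, Equiv.toEmbedding_apply, Equiv.coe_addRight] at hk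
  obtain ⟨a, ha, rfl⟩ := hk
  simp only [Finset.mem_insert, Finset.mem_Icc]
  omega

theorem sum_Icc_sub_one_le {U : ℤ → ℝ} (hU : ∀ n, 0 ≤ U n) (N : ℤ) :
    ∑ n ∈ Finset.Icc (-N) N, U (n - 1) ≤ ∑ n ∈ Finset.Icc (-N) N, U n + U (-(N + 1)) := by
  have h := Finset.sum_map (Finset.Icc (-N) N) (Equiv.subRight (1 : ℤ)).toEmbedding U
  simp only [Equiv.toEmbedding_apply, Equiv.subRight_apply] at h
  rw [← h, add_comm, ← Finset.sum_insert (s := Finset.Icc (-N) N) (a := -(N + 1)) (by simp)]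
  refine Finset.sum_le_sum_of_subset_of_nonneg (fun k hk => ?_) fun _ _ _ => hU _
  simp only [Finset.mem_map, Finset.mem_Icc, Equiv.toEmbedding_apply, Equiv.subRight_apply] at hk
  obtain ⟨a, ha, rfl⟩ := hk
  simp only [Finset.mem_insert, Finset.mem_Icc]
  omega

end Shift

section Pointwise

theorem le_mul_one_add_rpow {x M p : ℝ} (hx : 0 ≤ x) (hM : 0 < M) (hp : 1 ≤ p) :
    x ≤ M * (1 + (x / M) ^ p) := by
  have h0 : 0 ≤ (x / M) ^ p := Real.rpow_nonneg (by positivity) _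
  rcases le_total x M with h | h
  · nlinarith
  · have h1 : x / M ≤ (x / M) ^ p := Real.self_le_rpow_of_one_le ((one_le_div hM).2 h) hp
    calc x = M * (x / M) := by field_simp
      _ ≤ _ := by gcongr; linarith

/-- The pointwise bound on `|v|²` obtained from weighted `ℓ^{2p}` control. -/
def supBound (S : Finset ℤ) (L q p : ℝ) (v : ℤ → ℂ) : ℝ :=
  L ^ (q / p) * (1 + ∑ m ∈ S, L ^ (-q) * ‖v m‖ ^ (2 * p))

theorem supBound_nonneg {S : Finset ℤ} {L q p : ℝ} (hL : 0 < L) (v : ℤ → ℂ) :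
    0 ≤ supBound S L q p v :=
  mul_nonneg (Real.rpow_nonneg hL.le _) (add_nonneg zero_le_one (Finset.sum_nonneg fun _ _ =>
    mul_nonneg (Real.rpow_nonneg hL.le _) (Real.rpow_nonneg (norm_nonneg _) _)))

theorem sq_norm_le_supBound {S : Finset ℤ} {L q p : ℝ} (hL : 0 < L) (hp : 1 ≤ p) {v : ℤ → ℂ}
    {n : ℤ} (hn : n ∈ S) : ‖v n‖ ^ 2 ≤ supBound S L q p v := by
  have hM : 0 < L ^ (q / p) := Real.rpow_pos_of_pos hL _
  refine (le_mul_one_add_rpow (sq_nonneg ‖v n‖) hM hp).trans ?_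
  have h1 : (‖v n‖ ^ 2 / L ^ (q / p)) ^ p = L ^ (-q) * ‖v n‖ ^ (2 * p) := by
    rw [Real.div_rpow (sq_nonneg _) hM.le, ← Real.rpow_mul hL.le, div_mul_cancel₀ _ (by positivity),
      Real.rpow_neg hL.le, Real.rpow_mul (norm_nonneg _), Real.rpow_ofNat, div_eq_inv_mul]
  rw [h1]
  unfold supBound
  gcongr
  exact Finset.single_le_sum (f := fun m => L ^ (-q) * ‖v m‖ ^ (2 * p)) (fun m _ =>
    mul_nonneg (Real.rpow_nonneg hL.le _) (Real.rpow_nonneg (norm_nonneg _) _)) hn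

theorem abs_inner_alDifference_le (a ap am g gp gm : ℂ) :
    |2 * inner ℝ (a - g) (Complex.I * ((1 + (Complex.normSq a : ℂ)) * (ap + am) - 2 * a)
        - Complex.I * ((1 + (Complex.normSq g : ℂ)) * (gp + gm) - 2 * g))|
      ≤ 2 * ‖a - g‖ * ((1 + ‖a‖ ^ 2) * (‖ap - gp‖ + ‖am - gm‖)
        + ‖a - g‖ * (‖a‖ + ‖g‖) * (‖gp‖ + ‖gm‖)) := by
  have h1 : inner ℝ (a - g) (Complex.I * ((1 + (Complex.normSq a : ℂ)) * (ap + am) - 2 * a)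
        - Complex.I * ((1 + (Complex.normSq g : ℂ)) * (gp + gm) - 2 * g))
      = inner ℝ (a - g) (Complex.I * ((1 + (Complex.normSq a : ℂ)) * ((ap - gp) + (am - gm))
        + ((Complex.normSq a - Complex.normSq g : ℝ) : ℂ) * (gp + gm))) := by
    simp [Complex.inner]
    ring
  rw [h1, abs_mul, abs_two, mul_assoc]
  refine mul_le_mul_of_nonneg_left ((abs_real_inner_le_norm _ _).trans ?_) zero_le_two
  refine mul_le_mul_of_nonneg_left ?_ (norm_nonneg _)
  rw [norm_mul, Complex.norm_I, one_mul]
  refine (norm_add_le _ _).trans (add_le_add ?_ ?_)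
  · rw [norm_mul]
    refine mul_le_mul ?_ (norm_add_le _ _) (norm_nonneg _) (by positivity)
    refine (norm_add_le _ _).trans_eq ?_
    rw [norm_one, Complex.norm_real, Complex.normSq_eq_norm_sq, Real.norm_of_nonneg (sq_nonneg _)]
  · rw [norm_mul, Complex.norm_real, Complex.normSq_eq_norm_sq, Complex.normSq_eq_norm_sq]
    refine mul_le_mul ?_ (norm_add_le _ _) (norm_nonneg _) (by positivity)
    rw [sq_sub_sq, norm_mul, mul_comm]
    refine mul_le_mul (abs_norm_sub_norm_le a g) ?_ (norm_nonneg _) (norm_nonneg _)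
    rw [Real.norm_of_nonneg (by positivity)]

end Pointwise

section Comparison

theorem ALSolution.hasDerivAt {α : ℤ → ℝ → ℂ} (h : ALSolution α) (n : ℤ) (t : ℝ) :
    HasDerivAt (α n) (Complex.I * ((1 + (Complex.normSq (α n t) : ℂ))
      * (α (n + 1) t + α (n - 1) t) - 2 * α n t)) t := by
  obtain ⟨d, hd, he⟩ := h n t
  convert! hd using 1
  have : d = -Complex.I * (Complex.I * d) := by
    rw [← mul_assoc, neg_mul, Complex.I_mul_I]; ring
  rw [this, he]
  ring

/-- `γ` solves the Ablowitz–Ladik system on `[-N, N]` with zero boundary conditions. -/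
structure IsTruncatedSolution (N : ℕ) (γ : ℤ → ℝ → ℂ) : Prop where
  eq_zero : ∀ n ∉ Finset.Icc (-N : ℤ) N, ∀ t, γ n t = 0
  hasDerivAt : ∀ n ∈ Finset.Icc (-N : ℤ) N, ∀ t,
    HasDerivAt (γ n) (Complex.I * ((1 + (Complex.normSq (γ n t) : ℂ))
      * (γ (n + 1) t + γ (n - 1) t) - 2 * γ n t)) t

theorem IsTruncatedSolution.continuous {N : ℕ} {γ : ℤ → ℝ → ℂ} (h : IsTruncatedSolution N γ)
    (n : ℤ) : Continuous (γ n) := by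
  by_cases hn : n ∈ Finset.Icc (-N : ℤ) N
  · exact continuous_iff_continuousAt.2 fun t => (h.hasDerivAt n hn t).continuousAt
  · rw [show γ n = fun _ => 0 from funext (h.eq_zero n hn)]
    exact continuous_const

theorem weighted_growth_le {w u up um A G Gp Gm D₁ D₂ : ℝ} (hw : 0 ≤ w)
    (hA : A ^ 2 ≤ D₁) (hG : G ^ 2 ≤ D₂) (hGp : Gp ^ 2 ≤ D₂) (hGm : Gm ^ 2 ≤ D₂) :
    w * (2 * u * ((1 + A ^ 2) * (up + um) + u * (A + G) * (Gp + Gm)))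
      ≤ (1 + D₁) * (2 * (w * u ^ 2) + w * up ^ 2 + w * um ^ 2)
        + 2 * (w * u ^ 2) * (D₁ + 3 * D₂) := by
  have h1 : 2 * u * (up + um) ≤ 2 * u ^ 2 + up ^ 2 + um ^ 2 := by
    nlinarith [sq_nonneg (u - up), sq_nonneg (u - um)]
  have h2 : (A + G) * (Gp + Gm) ≤ D₁ + 3 * D₂ := by
    nlinarith [sq_nonneg (A - Gp), sq_nonneg (A - Gm), sq_nonneg (G - Gp), sq_nonneg (G - Gm)]
  have h3 : (1 + A ^ 2) * (2 * u * (up + um)) ≤ (1 + D₁) * (2 * u ^ 2 + up ^ 2 + um ^ 2) :=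
    (mul_le_mul_of_nonneg_left h1 (by positivity)).trans
      (mul_le_mul_of_nonneg_right (by linarith) (by positivity))
  have h4 : 2 * u ^ 2 * ((A + G) * (Gp + Gm)) ≤ 2 * u ^ 2 * (D₁ + 3 * D₂) :=
    mul_le_mul_of_nonneg_left h2 (by positivity)
  have := mul_le_mul_of_nonneg_left (add_le_add h3 h4) hw
  nlinarith [this]

theorem continuous_supBound {S : Finset ℤ} {L q p : ℝ} (hp : 0 ≤ p) {v : ℤ → ℝ → ℂ}
    (hv : ∀ n, Continuous (v n)) : Continuous fun t => supBound S L q p fun n => v n t := by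
  unfold supBound
  refine continuous_const.mul (continuous_const.add (continuous_finsetSum _ fun m _ =>
    continuous_const.mul ?_))
  exact (hv m).norm.rpow_const fun _ => Or.inr (by positivity)

theorem weighted_sq_norm_sub_le {α γ : ℤ → ℝ → ℂ} {N : ℕ} {c C T L q p q' p' : ℝ}
    (hα : ALSolution α) (hγ : IsTruncatedSolution N γ) (hc : 0 < c) (hC0 : 0 ≤ C)
    (hL : 0 < L) (hp : 1 ≤ p) (hp' : 1 ≤ p')
    (hC : ∀ t ∈ Icc (-T) T, ∀ n, Real.exp (-(c * jap n)) * ‖α n t‖ ^ 2 ≤ C)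
    (h0 : ∀ n ∈ Finset.Icc (-N : ℤ) N, γ n 0 = α n 0) :
    ∀ t ∈ Icc (-T) T, ∀ n ∈ Finset.Icc (-N : ℤ) N,
      Real.exp (-(2 * c * jap n)) * ‖α n t - γ n t‖ ^ 2
        ≤ C * Real.exp (-(c * N)) * Real.exp (∫ s in -T..T, (8 + 2 * Real.exp (2 * c))
          * (1 + supBound (Finset.Icc (-N : ℤ) N) L q p (fun n => α n s)
            + supBound (Finset.Icc (-N : ℤ) N) L q' p' (fun n => γ n s))) := by
  set S := Finset.Icc (-N : ℤ) N with hS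
  set U : ℝ → ℤ → ℝ := fun t n => Real.exp (-(2 * c * jap n)) * ‖α n t - γ n t‖ ^ 2 with hU
  set ε : ℝ := C * Real.exp (-(c * N)) with hε
  set D₁ : ℝ → ℝ := fun s => supBound S L q p (fun n => α n s) with hD₁
  set D₂ : ℝ → ℝ := fun s => supBound S L q' p' (fun n => γ n s) with hD₂
  set a : ℝ → ℝ := fun s => (8 + 2 * Real.exp (2 * c)) * (1 + D₁ s + D₂ s) with ha
  have hU0 : ∀ t n, 0 ≤ U t n := fun t n => by positivity
  have hε0 : 0 ≤ ε := by positivity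
  have hD₁0 : ∀ s, 0 ≤ D₁ s := fun s => supBound_nonneg hL _
  have hD₂0 : ∀ s, 0 ≤ D₂ s := fun s => supBound_nonneg hL _
  have hαc : ∀ n, Continuous (α n) := fun n =>
    continuous_iff_continuousAt.2 fun t => (hα.hasDerivAt n t).continuousAt
  have hac : Continuous a := continuous_const.mul ((continuous_const.add
    (continuous_supBound (by linarith) hαc)).add
    (continuous_supBound (by linarith) hγ.continuous))
  have ha0 : ∀ s, 0 ≤ a s := fun s => by
    have := hD₁0 s
    have := hD₂0 s
    positivity
  have hder : ∀ t, HasDerivAt (fun t => ∑ n ∈ S, U t n + ε)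
      (∑ n ∈ S, Real.exp (-(2 * c * jap n)) * (2 * inner ℝ (α n t - γ n t)
        (Complex.I * ((1 + (Complex.normSq (α n t) : ℂ)) * (α (n + 1) t + α (n - 1) t)
          - 2 * α n t) - Complex.I * ((1 + (Complex.normSq (γ n t) : ℂ))
            * (γ (n + 1) t + γ (n - 1) t) - 2 * γ n t)))) t := fun t =>
    (HasDerivAt.fun_sum fun n hn =>
      ((((hα.hasDerivAt n t).sub (hγ.hasDerivAt n hn t)).norm_sq).const_mul _)).add_const ε
  have hbd : ∀ t ∈ Icc (-T) T, ∀ k : ℤ, (N : ℝ) ≤ jap k → k ∉ S → U t k ≤ ε := by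
    intro t ht k hk hkS
    have h1 : U t k = Real.exp (-(c * jap k)) * (Real.exp (-(c * jap k)) * ‖α k t‖ ^ 2) := by
      simp only [hU, hγ.eq_zero k hkS, sub_zero]
      rw [← mul_assoc, ← Real.exp_add]
      ring_nf
    rw [h1, hε, mul_comm C]
    refine mul_le_mul ?_ (hC t ht k) (by positivity) (Real.exp_pos _).le
    rw [Real.exp_le_exp]
    nlinarith
  have hmain : ∀ t ∈ Icc (-T) T, |∑ n ∈ S, Real.exp (-(2 * c * jap n))
      * (2 * inner ℝ (α n t - γ n t)
        (Complex.I * ((1 + (Complex.normSq (α n t) : ℂ)) * (α (n + 1) t + α (n - 1) t)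
          - 2 * α n t) - Complex.I * ((1 + (Complex.normSq (γ n t) : ℂ))
            * (γ (n + 1) t + γ (n - 1) t) - 2 * γ n t)))| ≤ a t * (∑ n ∈ S, U t n + ε) := by
    intro t ht
    have hγD : ∀ k, ‖γ k t‖ ^ 2 ≤ D₂ t := fun k => by
      by_cases hk : k ∈ S
      · exact sq_norm_le_supBound (v := fun n => γ n t) hL hp' hk
      · simpa [hγ.eq_zero k hk] using hD₂0 t
    have hterm : ∀ n ∈ S, |Real.exp (-(2 * c * jap n)) * (2 * inner ℝ (α n t - γ n t)
        (Complex.I * ((1 + (Complex.normSq (α n t) : ℂ)) * (α (n + 1) t + α (n - 1) t)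
          - 2 * α n t) - Complex.I * ((1 + (Complex.normSq (γ n t) : ℂ))
            * (γ (n + 1) t + γ (n - 1) t) - 2 * γ n t)))|
        ≤ (1 + D₁ t) * (2 * U t n + Real.exp (2 * c) * U t (n + 1)
          + Real.exp (2 * c) * U t (n - 1)) + 2 * U t n * (D₁ t + 3 * D₂ t) := by
      intro n hn
      have hw := Real.exp_pos (-(2 * c * jap n))
      rw [abs_mul, abs_of_pos hw]
      refine (mul_le_mul_of_nonneg_left (abs_inner_alDifference_le _ _ _ _ _ _) hw.le).trans ?_
      refine (weighted_growth_le hw.le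
        (sq_norm_le_supBound (v := fun n => α n t) hL hp hn : _ ≤ D₁ t)
        (hγD n) (hγD (n + 1)) (hγD (n - 1))).trans ?_
      have hs : ∀ k : ℤ, |k - n| ≤ 1 → Real.exp (-(2 * c * jap n)) * ‖α k t - γ k t‖ ^ 2
          ≤ Real.exp (2 * c) * U t k := fun k hk => by
        rw [hU, ← mul_assoc]
        exact mul_le_mul_of_nonneg_right (exp_neg_jap_le (by linarith) hk) (sq_nonneg _)
      have h1 := hs (n + 1) (by simp)
      have h2 := hs (n - 1) (by simp)
      have h3 := hD₁0 t
      gcongr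
    have hr := sum_Icc_add_one_le (hU0 t) N
    have hl := sum_Icc_sub_one_le (hU0 t) N
    have hjap : ∀ k : ℤ, |k| = N + 1 → (N : ℝ) ≤ jap k := fun k hk => by
      refine le_trans ?_ (abs_le_jap k)
      have : |(k : ℝ)| = N + 1 := by exact_mod_cast hk
      linarith
    have hr' := hbd t ht (N + 1) (hjap _ (by rw [abs_of_nonneg]; positivity)) (by simp [hS])
    have hl' := hbd t ht (-(N + 1)) (hjap _ (by rw [abs_neg, abs_of_nonneg]; positivity))
      (by simp [hS])
    refine (Finset.abs_sum_le_sum_abs _ _).trans ((Finset.sum_le_sum hterm).trans ?_)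
    rw [Finset.sum_add_distrib, ← Finset.mul_sum, Finset.sum_add_distrib, Finset.sum_add_distrib,
      ← Finset.mul_sum, ← Finset.mul_sum, ← Finset.mul_sum, ← Finset.sum_mul, ← Finset.mul_sum]
    set Q := ∑ n ∈ S, U t n with hQ
    have hQ0 : 0 ≤ Q := Finset.sum_nonneg fun n _ => hU0 t n
    have h3 := hD₁0 t
    have h4 := hD₂0 t
    have h5 := Real.exp_pos (2 * c)
    have h6 : ∑ n ∈ S, U t (n + 1) ≤ Q + ε := hr.trans (by linarith)
    have h7 : ∑ n ∈ S, U t (n - 1) ≤ Q + ε := hl.trans (by linarith)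
    calc _ ≤ (1 + D₁ t) * (2 * (Q + ε) + Real.exp (2 * c) * (Q + ε)
          + Real.exp (2 * c) * (Q + ε)) + 2 * (Q + ε) * (D₁ t + 3 * D₂ t) := by
          gcongr <;> linarith
      _ = (2 + 2 * Real.exp (2 * c) + (4 + 2 * Real.exp (2 * c)) * D₁ t + 6 * D₂ t)
          * (Q + ε) := by ring
      _ ≤ a t * (Q + ε) := by
          refine mul_le_mul_of_nonneg_right ?_ (by linarith)
          simp only [ha]
          nlinarith [mul_nonneg h5.le h4]
  have hgr := le_mul_exp_integral_of_abs_deriv_le hder hac ha0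
    (fun t => add_nonneg (Finset.sum_nonneg fun n _ => hU0 t n) hε0) hmain
  intro t ht n hn
  have h1 := hgr t ht
  have h2 : ∑ n ∈ S, U 0 n = 0 := Finset.sum_eq_zero fun n hn => by simp [hU, h0 n hn]
  rw [h2, zero_add] at h1
  refine le_trans ?_ h1
  have h3 := Finset.single_le_sum (fun n _ => hU0 t n) hn
  linarith

end Comparison

section Convergence

theorem tendsto_exp_neg_add_rpow {c : ℝ} (hc : 0 < c) (C κ A B D : ℝ) {θ θ' : ℝ} (hθ : θ < 1)
    (hθ' : θ' < 1) :
    Tendsto (fun N : ℕ => C * Real.exp (-(c * N)) * Real.exp (κ * (D + ((N : ℝ) + 1) ^ θ * A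
      + ((N : ℝ) + 1) ^ θ' * B))) atTop (𝓝 0) := by
  have hN : Tendsto (fun N : ℕ => (N : ℝ) + 1) atTop atTop :=
    tendsto_atTop_add_const_right _ _ tendsto_natCast_atTop_atTop
  have hr : ∀ s : ℝ, s < 1 → Tendsto (fun x : ℝ => x ^ (s - 1)) atTop (𝓝 0) := fun s hs => by
    simpa using tendsto_rpow_neg_atTop (y := 1 - s) (by linarith)
  have h1 : Tendsto (fun x : ℝ => -c + (c + κ * D) * x⁻¹ + κ * A * x ^ (θ - 1)
      + κ * B * x ^ (θ' - 1)) atTop (𝓝 (-c)) := by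
    have := (((tendsto_const_nhds (x := -c)).add
      ((tendsto_inv_atTop_zero (𝕜 := ℝ)).const_mul (c + κ * D))).add
      ((hr θ hθ).const_mul (κ * A))).add ((hr θ' hθ').const_mul (κ * B))
    simpa using this
  have h2 : Tendsto (fun x : ℝ => x * (-c + (c + κ * D) * x⁻¹ + κ * A * x ^ (θ - 1)
      + κ * B * x ^ (θ' - 1))) atTop atBot :=
    tendsto_id.atTop_mul_neg (by linarith) h1
  have h3 := ((Real.tendsto_exp_atBot.comp (h2.comp hN)).const_mul C)
  rw [mul_zero] at h3
  refine h3.congr fun N => ?_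
  have hpos : (0 : ℝ) < N + 1 := by positivity
  simp only [Function.comp_apply]
  rw [mul_assoc C (Real.exp _), ← Real.exp_add, Real.rpow_sub_one hpos.ne',
    Real.rpow_sub_one hpos.ne']
  congr 2
  field_simp
  ring

theorem integral_supBound_le {S : Finset ℤ} {L q p T M : ℝ} (hL : 0 < L) (hp : 0 ≤ p)
    {v : ℤ → ℝ → ℂ} (hv : ∀ n, Continuous (v n))
    (hM : ∫ s in -T..T, ∑ m ∈ S, L ^ (-q) * ‖v m s‖ ^ (2 * p) ≤ M) :
    ∫ s in -T..T, supBound S L q p (fun n => v n s) ≤ L ^ (q / p) * (2 * T + M) := by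
  have hc : Continuous fun s => ∑ m ∈ S, L ^ (-q) * ‖v m s‖ ^ (2 * p) :=
    continuous_finsetSum _ fun m _ => continuous_const.mul
      ((hv m).norm.rpow_const fun _ => Or.inr (by positivity))
  unfold supBound
  rw [intervalIntegral.integral_const_mul, intervalIntegral.integral_add
    (by simp) (hc.intervalIntegrable _ _), intervalIntegral.integral_const, smul_eq_mul, mul_one]
  have := Real.rpow_nonneg hL.le (q / p)
  gcongr
  linarith

theorem intervalIntegral_le_toReal_lintegral {f : ℝ → ℝ} (hf : Continuous f) (h0 : ∀ s, 0 ≤ f s)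
    {T : ℝ} (hT : 0 ≤ T) {g : ℝ → ℝ≥0∞} (hg : ∀ s, ENNReal.ofReal (f s) ≤ g s)
    (hfin : ∫⁻ s in Icc (-T) T, g s < ⊤) :
    ∫ s in -T..T, f s ≤ (∫⁻ s in Icc (-T) T, g s).toReal := by
  rw [intervalIntegral.integral_of_le (by linarith),
    integral_eq_lintegral_of_nonneg_ae (Eventually.of_forall h0) hf.aestronglyMeasurable]
  exact ENNReal.toReal_mono hfin.ne ((lintegral_mono_set Ioc_subset_Icc_self).trans
    (lintegral_mono hg))

/-- Good solutions are limits of the truncated solutions with the same data, as long as the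
latter satisfy a linear-in-`N` space-time bound. -/
theorem IsGoodALSolution.exists_bound {α : ℤ → ℝ → ℂ} (hα : IsGoodALSolution α) {T : ℝ}
    (hT : 0 < T) {p' : ℝ} (hp' : 1 < p') (K : ℝ) :
    ∃ (c : ℝ) (b : ℕ → ℝ), Tendsto b atTop (𝓝 0) ∧ ∀ (N : ℕ) (γ : ℤ → ℝ → ℂ),
      IsTruncatedSolution N γ → (∀ n ∈ Finset.Icc (-N : ℤ) N, γ n 0 = α n 0) →
      ∫ s in -T..T, ∑ m ∈ Finset.Icc (-N : ℤ) N, ‖γ m s‖ ^ (2 * p') ≤ K * (N + 1) →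
      ∀ t ∈ Icc (-T) T, ∀ n ∈ Finset.Icc (-N : ℤ) N,
        ‖α n t - γ n t‖ ^ 2 ≤ Real.exp (2 * c * jap n) * b N := by
  obtain ⟨hsol, ⟨p, q, hq, hqp, hpq⟩, ⟨c, hc, hsup⟩⟩ := hα
  have hp : 1 < p := hq.trans hqp
  set C : ℝ := (⨆ t ∈ Icc (-T) T, ∑' n : ℤ,
    ENNReal.ofReal (Real.exp (-(c * jap n)) * ‖α n t‖ ^ 2)).toReal with hCdef
  have hC : ∀ t ∈ Icc (-T) T, ∀ n, Real.exp (-(c * jap n)) * ‖α n t‖ ^ 2 ≤ C := by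
    intro t ht n
    rw [← ENNReal.ofReal_le_iff_le_toReal (hsup T hT).ne]
    exact (ENNReal.le_tsum (f := fun n : ℤ => ENNReal.ofReal
      (Real.exp (-(c * jap n)) * ‖α n t‖ ^ 2)) n).trans
      (le_iSup₂ (f := fun t (_ : t ∈ Icc (-T) T) => ∑' n : ℤ,
        ENNReal.ofReal (Real.exp (-(c * jap n)) * ‖α n t‖ ^ 2)) t ht)
  have hαc : ∀ n, Continuous (α n) := fun n =>
    continuous_iff_continuousAt.2 fun t => (hsol.hasDerivAt n t).continuousAt
  set M : ℝ := (∫⁻ t in Icc (-T) T, ∑' n : ℤ,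
    ENNReal.ofReal (jap n ^ (-q) * ‖α n t‖ ^ (2 * p))).toReal with hM
  set κ : ℝ := 8 + 2 * Real.exp (2 * c) with hκ
  refine ⟨c, _, tendsto_exp_neg_add_rpow hc C κ (2 * T + M) (2 * T + K) (2 * T)
    (θ := q / p) (θ' := 1 / p') ((div_lt_one (by linarith)).2 hqp)
    ((div_lt_one (by linarith)).2 hp'), fun N γ hγ h0 hK t ht n hn => ?_⟩
  have hL : (0 : ℝ) < N + 1 := by positivity
  have h1 := weighted_sq_norm_sub_le (q := q) (q' := 1) hsol hγ hc ENNReal.toReal_nonneg hL hp.le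
    hp'.le hC h0 t ht n hn
  have hI1 : ∫ s in -T..T, supBound (Finset.Icc (-N : ℤ) N) ((N : ℝ) + 1) q p (fun n => α n s)
      ≤ ((N : ℝ) + 1) ^ (q / p) * (2 * T + M) := by
    refine integral_supBound_le hL (by linarith) hαc ?_
    refine intervalIntegral_le_toReal_lintegral ?_ ?_ hT.le (fun s => ?_) (hpq T hT)
    · exact continuous_finsetSum _ fun m _ => continuous_const.mul
        ((hαc m).norm.rpow_const fun _ => Or.inr (by linarith))
    · exact fun s => Finset.sum_nonneg fun _ _ => mul_nonneg (Real.rpow_nonneg hL.le _)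
        (Real.rpow_nonneg (norm_nonneg _) _)
    · rw [ENNReal.ofReal_sum_of_nonneg fun _ _ => mul_nonneg (Real.rpow_nonneg hL.le _)
        (Real.rpow_nonneg (norm_nonneg _) _)]
      refine le_trans (Finset.sum_le_sum fun m hm => ENNReal.ofReal_le_ofReal ?_)
        (ENNReal.sum_le_tsum (Finset.Icc (-N : ℤ) N))
      refine mul_le_mul_of_nonneg_right ?_ (Real.rpow_nonneg (norm_nonneg _) _)
      refine Real.rpow_le_rpow_of_nonpos (by linarith [one_le_jap m]) ?_ (by linarith)
      refine jap_le_of_abs_le ?_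
      have : |m| ≤ N := abs_le.2 (Finset.mem_Icc.1 hm)
      exact_mod_cast this
  have hI2 : ∫ s in -T..T, supBound (Finset.Icc (-N : ℤ) N) ((N : ℝ) + 1) 1 p' (fun n => γ n s)
      ≤ ((N : ℝ) + 1) ^ (1 / p') * (2 * T + K) := by
    refine integral_supBound_le hL (by linarith) hγ.continuous ?_
    simp only [← Finset.mul_sum]
    rw [intervalIntegral.integral_const_mul, Real.rpow_neg_one, inv_mul_le_iff₀ hL]
    exact hK.trans_eq (mul_comm _ _)
  have hcont1 := continuous_supBound (S := Finset.Icc (-N : ℤ) N) (L := (N : ℝ) + 1) (q := q)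
    (p := p) (by linarith) hαc
  have hcont2 := continuous_supBound (S := Finset.Icc (-N : ℤ) N) (L := (N : ℝ) + 1) (q := 1)
    (p := p') (by linarith) hγ.continuous
  have hI : ∫ s in -T..T, κ * (1 + supBound (Finset.Icc (-N : ℤ) N) ((N : ℝ) + 1) q p
        (fun n => α n s) + supBound (Finset.Icc (-N : ℤ) N) ((N : ℝ) + 1) 1 p' (fun n => γ n s))
      ≤ κ * (2 * T + ((N : ℝ) + 1) ^ (q / p) * (2 * T + M)
        + ((N : ℝ) + 1) ^ (1 / p') * (2 * T + K)) := by
    rw [intervalIntegral.integral_const_mul, intervalIntegral.integral_add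
      (f := fun s => 1 + supBound (Finset.Icc (-N : ℤ) N) ((N : ℝ) + 1) q p (fun n => α n s))
      ((continuous_const.add hcont1).intervalIntegrable _ _) (hcont2.intervalIntegrable _ _),
      intervalIntegral.integral_add (by simp) (hcont1.intervalIntegrable _ _),
      intervalIntegral.integral_const, smul_eq_mul, mul_one]
    gcongr
    linarith
  have h2 : Real.exp (-(2 * c * jap n)) * ‖α n t - γ n t‖ ^ 2
      ≤ C * Real.exp (-(c * N)) * Real.exp (κ * (2 * T + ((N : ℝ) + 1) ^ (q / p) * (2 * T + M)
        + ((N : ℝ) + 1) ^ (1 / p') * (2 * T + K))) := by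
    refine h1.trans ?_
    have : 0 ≤ C := ENNReal.toReal_nonneg
    gcongr
  calc ‖α n t - γ n t‖ ^ 2
      = Real.exp (2 * c * jap n) * (Real.exp (-(2 * c * jap n)) * ‖α n t - γ n t‖ ^ 2) := by
        rw [← mul_assoc, ← Real.exp_add, add_neg_cancel, Real.exp_zero, one_mul]
    _ ≤ _ := mul_le_mul_of_nonneg_left h2 (Real.exp_pos _).le

end Convergence

section WhiteNoise

theorem IsWhiteNoise.isProbabilityMeasure_muBeta {β : ℝ} {μ : Measure (ℤ → ℂ)}
    (h : IsWhiteNoise β μ) : IsProbabilityMeasure (muBeta β) := by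
  have := h.1
  have h1 := h.2 {0} (fun _ => univ) fun _ => MeasurableSet.univ
  refine ⟨?_⟩
  simpa using h1.symm

/-- The finite-dimensional marginals of white noise are product measures. -/
theorem IsWhiteNoise.map_restrict {β : ℝ} {μ : Measure (ℤ → ℂ)} (h : IsWhiteNoise β μ)
    [IsProbabilityMeasure (muBeta β)] (F : Finset ℤ) :
    μ.map F.restrict = Measure.pi fun _ : F => muBeta β := by
  refine (Measure.pi_eq fun s hs => ?_).symm
  rw [Measure.map_apply (Finset.measurable_restrict F) (MeasurableSet.univ_pi hs)]
  let A : ℤ → Set ℂ := fun n => if hn : n ∈ F then s ⟨n, hn⟩ else univ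
  have hA : ∀ n, MeasurableSet (A n) := fun n => by
    by_cases hn : n ∈ F <;> simp [A, hn, hs]
  have h1 := h.2 F A hA
  have h2 : F.restrict ⁻¹' univ.pi s = {a : ℤ → ℂ | ∀ n ∈ F, a n ∈ A n} := by
    ext a
    simp only [mem_preimage, Set.mem_pi, mem_univ, true_implies, Subtype.forall, mem_ofPred_eq]
    refine forall₂_congr fun n hn => ?_
    simp [A, hn]
  rw [h2, h1, ← Finset.prod_coe_sort]
  exact Finset.prod_congr rfl fun n _ => by simp [A]

theorem lintegral_norm_rpow_muBeta_lt_top {β : ℝ} (hβ : 0 < β) :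
    ∫⁻ z, ENNReal.ofReal (‖z‖ ^ (2 * (1 + β))) ∂muBeta β < ⊤ := by
  have hm : Measurable fun z : ℂ => siteDensity β (1 + Complex.normSq z) :=
    (measurable_siteDensity β).comp (by fun_prop)
  rw [muBeta_eq, lintegral_withDensity_eq_lintegral_mul _ hm.ennreal_ofReal (by fun_prop)]
  have hint : Integrable fun z : ℂ =>
      (1 + 2 * β) / Real.pi * ((1 : ℝ) + ‖z‖ ^ 2) ^ (-(2 + 2 * β) / 2) :=
    (integrable_rpow_neg_one_add_norm_sq (by simp [hβ])).const_mul _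
  refine lt_of_le_of_lt (lintegral_mono fun z => ?_) hint.lintegral_lt_top
  rw [Pi.mul_apply, ← ENNReal.ofReal_mul (siteDensity_nonneg hβ
    (by positivity [Complex.normSq_nonneg z]))]
  refine ENNReal.ofReal_le_ofReal ?_
  rw [siteDensity, Complex.normSq_eq_norm_sq, mul_assoc]
  refine mul_le_mul_of_nonneg_left ?_ (by positivity)
  have h0 : (0 : ℝ) < 1 + ‖z‖ ^ 2 := by positivity
  calc (1 + ‖z‖ ^ 2) ^ (-(2 + 2 * β)) * ‖z‖ ^ (2 * (1 + β))
      = (1 + ‖z‖ ^ 2) ^ (-(2 + 2 * β)) * (‖z‖ ^ 2) ^ (1 + β) := by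
        rw [Real.rpow_mul (norm_nonneg z)]; norm_num
    _ ≤ (1 + ‖z‖ ^ 2) ^ (-(2 + 2 * β)) * (1 + ‖z‖ ^ 2) ^ (1 + β) := by
        gcongr; linarith
    _ = (1 + ‖z‖ ^ 2) ^ (-(2 + 2 * β) / 2) := by
        rw [← Real.rpow_add h0]; congr 1; ring

theorem exists_measure_lt_le {Ω : Type*} [MeasurableSpace Ω] (ν : Measure Ω) [IsFiniteMeasure ν]
    {g : Ω → ℝ} (hg : Measurable g) {ε : ℝ≥0∞} (hε : 0 < ε) : ∃ R : ℝ, ν {x | R < g x} ≤ ε := by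
  have h1 : Tendsto (fun R : ℝ => ν {x | R < g x}) atTop (𝓝 (ν (⋂ R : ℝ, {x | R < g x}))) :=
    tendsto_measure_iInter_atTop (fun R => (measurableSet_lt measurable_const hg).nullMeasurableSet)
      (fun R S h x (hx : S < g x) => lt_of_le_of_lt h hx) ⟨0, measure_ne_top _ _⟩
  have h2 : (⋂ R : ℝ, {x | R < g x}) = ∅ := by
    refine eq_empty_of_forall_notMem fun x hx => ?_
    exact lt_irrefl (g x) (mem_iInter.1 hx (g x))
  rw [h2, measure_empty] at h1
  obtain ⟨R, hR⟩ := (h1.eventually_lt_const hε).exists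
  exact ⟨R, hR.le⟩

/-- The expected space-time norm along a measure-preserving flow of a finite box. -/
theorem lintegral_sum_norm_rpow_flow {β T : ℝ} [IsProbabilityMeasure (muBeta β)]
    {F : Finset ℤ} {φ : ℝ → (F → ℂ) → (F → ℂ)}
    (hφ : Continuous fun p : ℝ × (F → ℂ) => φ p.1 p.2)
    (hinv : ∀ t, (Measure.pi fun _ : F => muBeta β).map (φ t) = Measure.pi fun _ : F => muBeta β)
    {p : ℝ} (hp : 0 ≤ p) :
    ∫⁻ x, (∫⁻ s in Icc (-T) T, ENNReal.ofReal (∑ m ∈ F, ‖zeroExt F (φ s x) m‖ ^ p))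
      ∂(Measure.pi fun _ : F => muBeta β)
      = ENNReal.ofReal (2 * T) * (F.card * ∫⁻ z, ENNReal.ofReal (‖z‖ ^ p) ∂muBeta β) := by
  have hc : Continuous fun y : F → ℂ => ∑ m ∈ F, ‖zeroExt F y m‖ ^ p :=
    continuous_finsetSum _ fun m _ =>
      ((contDiff_zeroExt m).continuous.norm).rpow_const fun _ => Or.inr hp
  have hs : ∀ s, ∫⁻ x, ENNReal.ofReal (∑ m ∈ F, ‖zeroExt F (φ s x) m‖ ^ p)
      ∂(Measure.pi fun _ : F => muBeta β) = F.card * ∫⁻ z, ENNReal.ofReal (‖z‖ ^ p) ∂muBeta β := by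
    intro s
    have hφs : Measurable (φ s) := (hφ.comp (Continuous.prodMk_right s)).measurable
    rw [← lintegral_map (f := fun y => ENNReal.ofReal (∑ m ∈ F, ‖zeroExt F y m‖ ^ p))
      hc.measurable.ennreal_ofReal hφs, hinv]
    simp_rw [ENNReal.ofReal_sum_of_nonneg fun m _ => Real.rpow_nonneg (norm_nonneg _) p]
    rw [lintegral_finsetSum _ fun m _ => (((contDiff_zeroExt m).continuous.norm.rpow_const
      fun _ => Or.inr hp).measurable.ennreal_ofReal)]
    rw [Finset.sum_congr rfl (g := fun _ => ∫⁻ z, ENNReal.ofReal (‖z‖ ^ p) ∂muBeta β)]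
    · simp
    · intro m hm
      have h1 := (measurePreserving_eval (fun _ : F => muBeta β) ⟨m, hm⟩).lintegral_comp
        (f := fun z => ENNReal.ofReal (‖z‖ ^ p)) (by fun_prop)
      rw [← h1]
      refine lintegral_congr fun x => ?_
      simp [zeroExt, hm]
  rw [lintegral_lintegral_swap]
  · simp_rw [hs]
    simp only [lintegral_const, Measure.restrict_apply MeasurableSet.univ, univ_inter,
      Real.volume_Icc]
    rw [mul_comm]
    congr 2
    ring
  · exact (hc.comp (hφ.comp continuous_swap)).measurable.ennreal_ofReal.aemeasurable

end WhiteNoise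

section Invariance

/-- On boxes of radius `N` there are measure-preserving flows which, off a set of small measure,
are truncated Ablowitz–Ladik solutions with a linear-in-`N` space-time bound. -/
theorem exists_truncated_flow_bound {β T : ℝ} (hβ : 0 < β) (hT : 0 < T)
    [IsProbabilityMeasure (muBeta β)] :
    ∃ C : ℝ, ∀ K > 0, ∀ N : ℕ,
      ∃ (φ : ℝ → (Finset.Icc (-N : ℤ) N → ℂ) → (Finset.Icc (-N : ℤ) N → ℂ))
        (E : Set (Finset.Icc (-N : ℤ) N → ℂ)), (∀ t, Measurable (φ t)) ∧
      (∀ x, φ 0 x = x) ∧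
      (∀ t, (Measure.pi fun _ : Finset.Icc (-N : ℤ) N => muBeta β).map (φ t)
        = Measure.pi fun _ : Finset.Icc (-N : ℤ) N => muBeta β) ∧
      MeasurableSet E ∧
      (Measure.pi fun _ : Finset.Icc (-N : ℤ) N => muBeta β).real Eᶜ ≤ 1 / ((N : ℝ) + 1) + C / K ∧
      ∀ x ∈ E, IsTruncatedSolution N (fun n s => zeroExt (Finset.Icc (-N : ℤ) N) (φ s x) n) ∧
        ∫ s in -T..T, ∑ m ∈ Finset.Icc (-N : ℤ) N,
          ‖zeroExt (Finset.Icc (-N : ℤ) N) (φ s x) m‖ ^ (2 * (1 + β)) ≤ K * (N + 1) := by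
  set M : ℝ≥0∞ := ∫⁻ z, ENNReal.ofReal (‖z‖ ^ (2 * (1 + β))) ∂muBeta β with hM
  have hMtop : M < ⊤ := lintegral_norm_rpow_muBeta_lt_top hβ
  refine ⟨4 * T * M.toReal, fun K hK N => ?_⟩
  set F := Finset.Icc (-N : ℤ) N with hF
  set ν : Measure (F → ℂ) := Measure.pi fun _ : F => muBeta β with hν
  have hN : (0 : ℝ) < N + 1 := by positivity
  have hp : 0 ≤ 2 * (1 + β) := by positivity
  obtain ⟨R, hR⟩ := exists_measure_lt_le ν (g := alMass F) contDiff_alMass.continuous.measurable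
    (ε := ENNReal.ofReal (1 / ((N : ℝ) + 1))) (by simpa using hN)
  obtain ⟨φ, hφc, hφ0, hφinv, hφd⟩ := exists_truncated_flow hβ F R
  have hc : Continuous fun y : F → ℂ => ∑ m ∈ F, ‖zeroExt F y m‖ ^ (2 * (1 + β)) :=
    continuous_finsetSum _ fun m _ =>
      ((contDiff_zeroExt m).continuous.norm).rpow_const fun _ => Or.inr hp
  set V : (F → ℂ) → ℝ≥0∞ := fun x => ∫⁻ s in Icc (-T) T,
    ENNReal.ofReal (∑ m ∈ F, ‖zeroExt F (φ s x) m‖ ^ (2 * (1 + β))) with hV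
  have hVm : Measurable V :=
    ((hc.comp (hφc.comp continuous_swap)).measurable.ennreal_ofReal).lintegral_prod_right'
  have hVint : ∫⁻ x, V x ∂ν = ENNReal.ofReal (2 * T) * (F.card * M) :=
    lintegral_sum_norm_rpow_flow hφc hφinv hp
  have hVint' : ∫⁻ x, V x ∂ν ≤ ENNReal.ofReal (4 * T * M.toReal * (N + 1)) := by
    rw [hVint, ← ENNReal.ofReal_toReal hMtop.ne, ← ENNReal.ofReal_natCast F.card,
      ← ENNReal.ofReal_mul (by positivity), ← ENNReal.ofReal_mul (by positivity)]
    refine ENNReal.ofReal_le_ofReal ?_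
    have h1 : (F.card : ℝ) ≤ 2 * (N + 1) := by
      have : F.card = 2 * N + 1 := by
        rw [hF, Int.card_Icc]; omega
      rw [this]; push_cast; linarith
    rw [ENNReal.toReal_ofReal ENNReal.toReal_nonneg]
    have := mul_le_mul_of_nonneg_left h1 (mul_nonneg hT.le M.toReal_nonneg)
    nlinarith
  have hKN : 0 < K * ((N : ℝ) + 1) := by positivity
  have hmark : ν {x | ENNReal.ofReal (K * (N + 1)) < V x}
      ≤ ENNReal.ofReal (4 * T * M.toReal / K) := by
    refine (measure_mono (t := {x | ENNReal.ofReal (K * (N + 1)) ≤ V x})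
      fun x (hx : ENNReal.ofReal (K * (N + 1)) < V x) => hx.le).trans
      ((meas_ge_le_lintegral_div hVm.aemeasurable (by simpa using hKN) ENNReal.ofReal_ne_top).trans ?_)
    refine (ENNReal.div_le_div_right hVint' _).trans ?_
    rw [← ENNReal.ofReal_div_of_pos hKN, mul_div_mul_right _ _ hN.ne']
  refine ⟨φ, {x | alMass F x ≤ R} ∩ {x | V x ≤ ENNReal.ofReal (K * (N + 1))},
    fun t => (hφc.comp (Continuous.prodMk_right t)).measurable, hφ0, hφinv,
    (measurableSet_le contDiff_alMass.continuous.measurable measurable_const).inter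
      (measurableSet_le hVm measurable_const), ?_, ?_⟩
  · have h0 : 0 ≤ 4 * T * M.toReal / K := by positivity
    refine ENNReal.toReal_le_of_le_ofReal (by positivity) ?_
    rw [compl_inter, ENNReal.ofReal_add (by positivity) h0]
    refine (measure_union_le _ _).trans (add_le_add ?_ ?_)
    · simpa only [compl_ofPred, not_le] using hR
    · simpa only [compl_ofPred, not_le] using hmark
  · rintro x ⟨hxR, hxV⟩
    refine ⟨⟨fun n hn t => zeroExt_of_notMem _ hn, fun n hn t => ?_⟩, ?_⟩
    · have h1 := hasDerivAt_pi.1 (hφd x hxR t) ⟨n, hn⟩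
      have h2 : ∀ y : F → ℂ, zeroExt F y n = y ⟨n, hn⟩ := fun y => zeroExt_coe y ⟨n, hn⟩
      simp only [h2]
      exact h1
    · refine (intervalIntegral_le_toReal_lintegral (hc.comp (hφc.comp (Continuous.prodMk_left x)))
        (fun s => Finset.sum_nonneg fun m _ => Real.rpow_nonneg (norm_nonneg _) _) hT.le
        (fun s => le_rfl) (lt_of_le_of_lt hxV ENNReal.ofReal_lt_top)).trans ?_
      exact ENNReal.toReal_le_of_le_ofReal hKN.le hxV

theorem abs_le_of_tendsto_indicator {Ω : Type*} [MeasurableSpace Ω] {μ : Measure Ω}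
    [IsProbabilityMeasure μ] {h : ℕ → Ω → ℝ} {E : ℕ → Set Ω} {B d I : ℝ} {r : ℕ → ℝ}
    (hh : ∀ N, Measurable (h N)) (hB : ∀ N x, |h N x| ≤ B) (hE : ∀ N, MeasurableSet (E N))
    (hlim : ∀ᵐ x ∂μ, Tendsto (fun N => (E N).indicator (h N) x) atTop (𝓝 0))
    (hd : ∀ N, μ.real (E N)ᶜ ≤ r N + d) (hr : Tendsto r atTop (𝓝 0))
    (hI : ∀ᶠ N in atTop, ∫ x, h N x ∂μ = I) : |I| ≤ B * d := by
  obtain ⟨x₀⟩ : Nonempty Ω := μ.nonempty_of_neZero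
  have hB0 : 0 ≤ B := (abs_nonneg _).trans (hB 0 x₀)
  have h1 : Tendsto (fun N => ∫ x, (E N).indicator (h N) x ∂μ) atTop (𝓝 (∫ _, (0 : ℝ) ∂μ)) := by
    refine tendsto_integral_of_dominated_convergence (fun _ => B)
      (fun N => ((hh N).indicator (hE N)).aestronglyMeasurable) (integrable_const B)
      (fun N => .of_forall fun x => ?_) hlim
    exact (norm_indicator_le_norm_self _ _).trans (hB N x)
  rw [integral_zero] at h1
  have h2 : ∀ N, |∫ x, h N x ∂μ| ≤ |∫ x, (E N).indicator (h N) x ∂μ| + B * (r N + d) := by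
    intro N
    have hint : Integrable (h N) μ := .of_bound (hh N).aestronglyMeasurable B
      (.of_forall (hB N))
    rw [← integral_add_compl (hE N) hint, integral_indicator (hE N)]
    refine (abs_add_le _ _).trans (add_le_add le_rfl ?_)
    refine (norm_setIntegral_le_of_norm_le_const (f := h N) (C := B) (measure_lt_top _ _)
      fun x _ => hB N x).trans ?_
    exact mul_le_mul_of_nonneg_left (hd N) hB0
  have h3 : Tendsto (fun N => |∫ x, (E N).indicator (h N) x ∂μ| + B * (r N + d)) atTop
      (𝓝 (|0| + B * (0 + d))) := h1.abs.add ((hr.add_const d).const_mul B)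
  simp only [abs_zero, zero_add] at h3
  refine ge_of_tendsto h3 (hI.mono fun N hN => hN ▸ h2 N)

theorem integral_lipschitz_comp_eq {β : ℝ} (hβ : 0 < β) {μ : Measure (ℤ → ℂ)}
    (hμ : IsWhiteNoise β μ) {Φ : ℝ → (ℤ → ℂ) → (ℤ → ℂ)} (hmeas : ∀ t : ℝ, Measurable (Φ t))
    (hsol : ∀ᵐ a ∂μ, IsGoodALSolution (fun (n : ℤ) (t : ℝ) => Φ t a n) ∧ Φ 0 a = a)
    (t : ℝ) (G : Finset ℤ) {f : (G → ℂ) → ℝ} {L : ℝ≥0} {B : ℝ} (hf : LipschitzWith L f)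
    (hB : ∀ x, ‖f x‖ ≤ B) :
    ∫ a, f (G.restrict (Φ t a)) ∂μ = ∫ a, f (G.restrict a) ∂μ := by
  have := hμ.1
  have := hμ.isProbabilityMeasure_muBeta
  have hT : 0 < |t| + 1 := by positivity
  have htT : t ∈ Icc (-(|t| + 1)) (|t| + 1) :=
    ⟨by linarith [neg_abs_le t], by linarith [le_abs_self t]⟩
  have hfm : Measurable f := hf.continuous.measurable
  obtain ⟨C, hC⟩ := exists_truncated_flow_bound hβ hT
  have key : ∀ K > 0, |∫ a, f (G.restrict (Φ t a)) ∂μ - ∫ a, f (G.restrict a) ∂μ|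
      ≤ (B + B) * (C / K) := by
    intro K hK
    choose φ E hφm hφ0 hφinv hE hEm hφE using hC K hK
    let Ψ : ℕ → (ℤ → ℂ) → (G → ℂ) := fun N a n =>
      zeroExt (Finset.Icc (-N : ℤ) N) (φ N t ((Finset.Icc (-N : ℤ) N).restrict a)) n
    have hz : ∀ N : ℕ, Measurable fun (y : Finset.Icc (-N : ℤ) N → ℂ) (n : G) =>
        zeroExt (Finset.Icc (-N : ℤ) N) y n := fun N =>
      measurable_pi_lambda _ fun n => (contDiff_zeroExt (n : ℤ)).continuous.measurable
    have hr : ∀ N : ℕ, Measurable ((Finset.Icc (-N : ℤ) N).restrict (π := fun _ => ℂ)) := fun N =>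
      Finset.measurable_restrict _
    have hΨ : ∀ N, Measurable (Ψ N) := fun N => (hz N).comp ((hφm N t).comp (hr N))
    have hfΦ : Measurable fun a => f (G.restrict (Φ t a)) :=
      hfm.comp ((Finset.measurable_restrict G).comp (hmeas t))
    have hsub : ∀ᶠ N : ℕ in atTop, G ⊆ Finset.Icc (-N : ℤ) N := by
      filter_upwards [eventually_ge_atTop (∑ n ∈ G, n.natAbs)] with N hN n hn
      have h1 : n.natAbs ≤ N := (Finset.single_le_sum (f := Int.natAbs)
        (fun _ _ => Nat.zero_le _) hn).trans hN
      rw [Finset.mem_Icc]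
      omega
    refine abs_le_of_tendsto_indicator (μ := μ)
      (h := fun N a => f (G.restrict (Φ t a)) - f (Ψ N a))
      (E := fun N => (Finset.Icc (-N : ℤ) N).restrict ⁻¹' E N)
      (r := fun N => 1 / ((N : ℝ) + 1)) (fun N => hfΦ.sub (hfm.comp (hΨ N)))
      (fun N a => (abs_sub _ _).trans (add_le_add (hB _) (hB _)))
      (fun N => hr N (hE N)) ?_ (fun N => ?_) tendsto_one_div_add_atTop_nhds_zero_nat ?_
    · filter_upwards [hsol] with a ha
      obtain ⟨c, b, hb, hbound⟩ := ha.1.exists_bound hT (p' := 1 + β) (by linarith) K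
      set M : ℝ := ∑ n ∈ G, Real.exp (2 * c * jap n) with hM
      have hlim : Tendsto (fun N => L * √(M * |b N|)) atTop (𝓝 0) := by
        have := ((hb.abs.const_mul M).sqrt).const_mul (L : ℝ)
        simpa using this
      refine squeeze_zero_norm' ?_ hlim
      filter_upwards [hsub] with N hN
      by_cases haE : a ∈ (Finset.Icc (-N : ℤ) N).restrict ⁻¹' E N
      · rw [indicator_of_mem haE]
        obtain ⟨h1, h2⟩ := hφE N _ haE
        have h3 := hbound N _ h1 (fun n hn => by
          rw [hφ0, ha.2]
          exact zeroExt_coe _ ⟨n, hn⟩) h2 t htT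
        refine (hf.dist_le_mul _ _).trans ?_
        refine mul_le_mul_of_nonneg_left ?_ L.2
        refine (dist_pi_le_iff (Real.sqrt_nonneg _)).2 fun n => ?_
        rw [dist_eq_norm]
        refine Real.le_sqrt_of_sq_le ((h3 n (hN n.2)).trans ?_)
        refine (mul_le_mul_of_nonneg_left (le_abs_self _) (Real.exp_pos _).le).trans ?_
        exact mul_le_mul_of_nonneg_right (Finset.single_le_sum
          (f := fun n => Real.exp (2 * c * jap n)) (fun _ _ => (Real.exp_pos _).le) n.2)
          (abs_nonneg _)
      · rw [indicator_of_notMem haE, norm_zero]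
        positivity
    · rw [← preimage_compl, ← map_measureReal_apply (hr N) (hE N).compl, hμ.map_restrict]
      exact hEm N
    · filter_upwards [hsub] with N hN
      rw [integral_sub]
      · congr 1
        have hH : ∀ m : Measure (Finset.Icc (-N : ℤ) N → ℂ), AEStronglyMeasurable
            (fun y : Finset.Icc (-N : ℤ) N → ℂ =>
              f fun n : G => zeroExt (Finset.Icc (-N : ℤ) N) y n) m := fun m =>
          (hfm.comp (hz N)).aestronglyMeasurable
        have h1 := integral_map (hr N).aemeasurable (μ := μ) (hH _)
        have h2 := integral_map (hφm N t).aemeasurable (hH _)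
          (μ := Measure.pi fun _ : Finset.Icc (-N : ℤ) N => muBeta β)
        have h3 := integral_map (hr N).aemeasurable (μ := μ)
          ((hfm.comp (hz N)).comp (hφm N t)).aestronglyMeasurable
        rw [hφinv] at h2
        rw [hμ.map_restrict] at h1 h3
        refine (h3.symm.trans (h2.symm.trans h1)).trans (integral_congr_ae (.of_forall fun a => ?_))
        refine congrArg f (funext fun n => ?_)
        exact zeroExt_coe _ ⟨n, hN n.2⟩
      · exact .of_bound hfΦ.aestronglyMeasurable B (.of_forall fun a => hB _)
      · exact .of_bound (hfm.comp (hΨ N)).aestronglyMeasurable B (.of_forall fun a => hB _)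
  rw [← sub_eq_zero, ← abs_nonpos_iff]
  have h1 : Tendsto (fun K : ℝ => (B + B) * (C / K)) atTop (𝓝 ((B + B) * 0)) :=
    (tendsto_const_nhds.div_atTop tendsto_id).const_mul _
  rw [mul_zero] at h1
  exact ge_of_tendsto h1 ((eventually_gt_atTop 0).mono key)

theorem map_eq_of_good_solution {β : ℝ} (hβ : 0 < β) {μ : Measure (ℤ → ℂ)}
    (hμ : IsWhiteNoise β μ) {Φ : ℝ → (ℤ → ℂ) → (ℤ → ℂ)} (hmeas : ∀ t : ℝ, Measurable (Φ t))
    (hsol : ∀ᵐ a ∂μ, IsGoodALSolution (fun (n : ℤ) (t : ℝ) => Φ t a n) ∧ Φ 0 a = a)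
    (t : ℝ) : μ.map (Φ t) = μ := by
  have := hμ.1
  have := Measure.isProbabilityMeasure_map (hmeas t).aemeasurable (μ := μ)
  refine IsProjectiveLimit.unique (P := fun G : Finset ℤ => μ.map G.restrict) (fun G => ?_)
    (fun G => rfl)
  have hG : Measurable (G.restrict (π := fun _ => ℂ)) := Finset.measurable_restrict G
  have := Measure.isProbabilityMeasure_map hG.aemeasurable (μ := μ)
  have := Measure.isProbabilityMeasure_map hG.aemeasurable (μ := μ.map (Φ t))
  refine ext_of_forall_lipschitz_integral_eq fun f L B hf hB => ?_
  have hfm : ∀ m : Measure (G → ℂ), AEStronglyMeasurable f m := fun m =>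
    hf.continuous.aestronglyMeasurable
  rw [Measure.map_map hG (hmeas t), integral_map (hG.comp (hmeas t)).aemeasurable (hfm _)]
  exact (integral_lipschitz_comp_eq hβ hμ hmeas hsol t G hf hB).trans
    (integral_map hG.aemeasurable (hfm _)).symm

end Invariance

end WhiteNoiseInvariance

/-- fix β > 0. If Φ(t,·) is Borel measurable for every t and for μ_wn^β-a.e.
a ∈ ℂ^ℤ the map (n,t) ↦ Φ(t,a)_n is a global good solution of the Ablowitz–Ladik system with
Φ(0,a) = a, then for every t the pushforward of μ_wn^β under Φ(t,·) equals μ_wn^β. -/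
theorem AL_white_noise_invariance (β : ℝ) (hβ : 0 < β)
    (μ : Measure (ℤ → ℂ)) (hμ : IsWhiteNoise β μ)
    (Φ : ℝ → (ℤ → ℂ) → (ℤ → ℂ))
    (hmeas : ∀ t : ℝ, Measurable (Φ t))
    (hsol : ∀ᵐ a ∂μ,
      IsGoodALSolution (fun (n : ℤ) (t : ℝ) => Φ t a n) ∧ Φ 0 a = a) :
    ∀ t : ℝ, μ.map (Φ t) = μ := by
  exact map_eq_of_good_solution hβ hμ hmeas hsol
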